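/- arXiv:1003.1224 — 3 statements merged into one kernel-verified Lean document; each statement's English description precedes it below -/
import Mathlib

section
/- An infinite word u over a two-letter alphabet is Sturmian (i.e., its factor complexity satisfies C(n) = n + 1 for all n ∈ ℕ) if and only if its palindromic complexity satisfies P(n) + P(n+1) = 3 for all n ∈ ℕ; equivalently, u contains exactly one palindromic factor of every even length and exactly two palindromic factors of every odd length. -/
open List

/-- The factor of `u` of length `n` starting at position `i`. -/
def word {A : Type*} (u : ℕ → A) (i n : ℕ) : List A :=
  (List.range n).map (fun j => u (i + j))

/-- `w` occurs in `u` at position `i`. -/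
def OccursAt {A : Type*} (u : ℕ → A) (w : List A) (i : ℕ) : Prop :=
  w = word u i w.length

/-- `w` is a factor of the infinite word `u`. -/
def IsFactor {A : Type*} (u : ℕ → A) (w : List A) : Prop :=
  ∃ i, OccursAt u w i

/-- Every letter of the alphabet occurs in `u`. -/
def AllLettersOccur {A : Type*} (u : ℕ → A) : Prop :=
  ∀ a : A, ∃ i, u i = a

/-- The language of `u` is closed under reversal. -/
def ClosedUnderReversal {A : Type*} (u : ℕ → A) : Prop :=
  ∀ w : List A, IsFactor u w → IsFactor u w.reverse

/-- `u` is uniformly recurrent: every factor occurs in every window of some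
bounded length. -/
def UniformlyRecurrent {A : Type*} (u : ℕ → A) : Prop :=
  ∀ w : List A, IsFactor u w → ∃ N : ℕ, ∀ i : ℕ, ∃ j : ℕ,
    i ≤ j ∧ j < i + N ∧ OccursAt u w j

/-- Factor complexity: the number of factors of `u` of length `n`. -/
noncomputable def complexity {A : Type*} (u : ℕ → A) (n : ℕ) : ℕ :=
  Set.ncard {w : List A | w.length = n ∧ IsFactor u w}

/-- Palindromic complexity: the number of palindromic factors of `u` of
length `n`. -/
noncomputable def palComplexity {A : Type*} (u : ℕ → A) (n : ℕ) : ℕ :=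
  Set.ncard {w : List A | w.length = n ∧ IsFactor u w ∧ w.reverse = w}

/-- The number of distinct palindromic factors of a finite word
(the empty word included). -/
noncomputable def palCount {A : Type*} (w : List A) : ℕ :=
  Set.ncard {v : List A | v <:+: w ∧ v.reverse = v}

/-- `u` is rich in palindromes. -/
def Rich {A : Type*} (u : ℕ → A) : Prop :=
  ∀ w : List A, IsFactor u w → palCount w = w.length + 1

/-- `j < k` are two successive occurrences of `w` in `u`. -/
def SuccOccurrences {A : Type*} (u : ℕ → A) (w : List A) (j k : ℕ) : Prop :=
  OccursAt u w j ∧ OccursAt u w k ∧ j < k ∧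
    ∀ l : ℕ, j < l → l < k → ¬ OccursAt u w l

/-- The set of return words of the factor `w` in `u`. -/
def returnWords {A : Type*} (u : ℕ → A) (w : List A) : Set (List A) :=
  {v | ∃ j k : ℕ, SuccOccurrences u w j k ∧ v = word u j (k - j)}

/-- Left extensions of `w` in `u`. -/
def Lext {A : Type*} (u : ℕ → A) (w : List A) : Set A :=
  {a | IsFactor u (a :: w)}

/-- Right extensions of `w` in `u`. -/
def Rext {A : Type*} (u : ℕ → A) (w : List A) : Set A :=
  {b | IsFactor u (w ++ [b])}

/-- Bilateral extensions of `w` in `u`. -/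
def Bext {A : Type*} (u : ℕ → A) (w : List A) : Set (A × A) :=
  {p | IsFactor u (p.1 :: (w ++ [p.2]))}

/-- Palindromic extensions of a (palindromic) factor `w` of `u`. -/
def Pext {A : Type*} (u : ℕ → A) (w : List A) : Set (List A) :=
  {v | ∃ a : A, v = a :: (w ++ [a]) ∧ IsFactor u v}

/-- `w` is a bispecial factor of `u`. -/
def Bispecial {A : Type*} (u : ℕ → A) (w : List A) : Prop :=
  IsFactor u w ∧ 2 ≤ Set.ncard (Lext u w) ∧ 2 ≤ Set.ncard (Rext u w)

/-- The bilateral order of a factor `w` of `u`. -/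
noncomputable def bilateralOrder {A : Type*} (u : ℕ → A) (w : List A) : ℤ :=
  (Set.ncard (Bext u w) : ℤ) - Set.ncard (Rext u w) - Set.ncard (Lext u w) + 1

/-- `u` is eventually periodic. -/
def EventuallyPeriodic {A : Type*} (u : ℕ → A) : Prop :=
  ∃ p : ℕ, 0 < p ∧ ∃ N : ℕ, ∀ n : ℕ, N ≤ n → u (n + p) = u n

/-- `u` is aperiodic. -/
def Aperiodic {A : Type*} (u : ℕ → A) : Prop :=
  ¬ EventuallyPeriodic u

/-- `u` is (1-)balanced. -/
def IsBalanced {A : Type*} [DecidableEq A] (u : ℕ → A) : Prop :=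
  ∀ a : A, ∀ w v : List A, IsFactor u w → IsFactor u v → w.length = v.length →
    |(w.count a : ℤ) - (v.count a : ℤ)| ≤ 1

section helpers

variable {A : Type*}

theorem length_word (u : ℕ → A) (i n : ℕ) : (word u i n).length = n := by
  simp [word]

theorem getElem_word (u : ℕ → A) (i n k : ℕ) (h : k < (word u i n).length) :
    (word u i n)[k] = u (i + k) := by
  simp [word]

theorem word_append (u : ℕ → A) (i n : ℕ) : word u i (n + 1) = word u i n ++ [u (i + n)] := by
  simp [word, List.range_succ]

theorem word_cons (u : ℕ → A) (i n : ℕ) : word u i (n + 1) = u i :: word u (i + 1) n := by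
  apply List.ext_getElem
  · simp [length_word]
  · intro k h1 h2
    rw [getElem_word]
    rcases k with _ | k
    · simp
    · simp [getElem_word]; congr 1; omega

theorem isFactor_word (u : ℕ → A) (i n : ℕ) : IsFactor u (word u i n) :=
  ⟨i, by simp [OccursAt, length_word]⟩

theorem exists_word {u : ℕ → A} {w : List A} {n : ℕ} (h : IsFactor u w) (hn : w.length = n) :
    ∃ i, w = word u i n := by
  subst hn; exact h

theorem f_tail {u : ℕ → A} {a : A} {w : List A} (h : IsFactor u (a :: w)) : IsFactor u w := by
  obtain ⟨i, hi⟩ := exists_word h (by simp : _ = w.length + 1)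
  rw [word_cons] at hi
  rw [(List.cons.inj hi).2]
  exact isFactor_word _ _ _

theorem f_init {u : ℕ → A} {a : A} {w : List A} (h : IsFactor u (w ++ [a])) : IsFactor u w := by
  obtain ⟨i, hi⟩ := exists_word h (by simp : _ = w.length + 1)
  rw [word_append] at hi
  rw [(List.append_inj' hi rfl).1]
  exact isFactor_word _ _ _

theorem f_ext {u : ℕ → A} {w : List A} (h : IsFactor u w) : ∃ a, IsFactor u (w ++ [a]) := by
  obtain ⟨i, hi⟩ := exists_word h rfl
  refine ⟨u (i + w.length), ?_⟩
  have := isFactor_word u i (w.length + 1)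
  rw [word_append, ← hi] at this
  exact this

/-- right special -/
def RS (u : ℕ → A) (w : List A) : Prop :=
  ∃ a b, a ≠ b ∧ IsFactor u (w ++ [a]) ∧ IsFactor u (w ++ [b])

def Uniq (u : ℕ → A) (n : ℕ) : Prop :=
  ∀ w w', w.length = n → w'.length = n → RS u w → RS u w' → w = w'

def Closed (u : ℕ → A) (n : ℕ) : Prop :=
  ∀ w, w.length = n → IsFactor u w → IsFactor u w.reverse

def Good (u : ℕ → A) (n : ℕ) : Prop :=
  ∀ w a b, w.length = n → w.reverse = w → IsFactor u (a :: (w ++ [a])) →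
    IsFactor u (b :: (w ++ [b])) → a = b

theorem per_of {u : ℕ → A} (bad : List A → Prop) (i q m : ℕ) (hq : 0 < q)
    (h0 : word u i m = word u (i + q) m)
    (hb : ∀ k < q, ¬ bad (word u (i + k) m))
    (hd : ∀ i' j', ¬ bad (word u i' m) → word u i' m = word u j' m → u (i' + m) = u (j' + m)) :
    EventuallyPeriodic u := by
  have key : ∀ k, word u (i + k) m = word u (i + q + k) m ∧ ¬ bad (word u (i + k) m) := by
    intro k
    induction k using Nat.strong_induction_on with
    | _ k ih =>
      have h1 : ¬ bad (word u (i + k) m) := by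
        by_cases hk : k < q
        · exact hb k hk
        · have := ih (k - q) (by omega)
          rw [this.1, show i + q + (k - q) = i + k by omega] at this
          exact this.2
      refine ⟨?_, h1⟩
      rcases k with _ | k
      · simpa using h0
      · obtain ⟨e, nb⟩ := ih k (by omega)
        have e2 := hd _ _ nb e
        have e3 : word u (i + k) (m + 1) = word u (i + q + k) (m + 1) := by
          rw [word_append, word_append, e, e2]
        rw [word_cons, word_cons] at e3
        exact (List.cons.inj e3).2
  refine ⟨q, hq, i + m, fun n hn => ?_⟩
  obtain ⟨e, nb⟩ := key (n - i - m)
  have := hd _ _ nb e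
  rw [show i + (n - i - m) + m = n by omega, show i + q + (n - i - m) + m = n + q by omega] at this
  exact this.symm

theorem finite_F [Finite A] (u : ℕ → A) (n : ℕ) :
    {w : List A | w.length = n ∧ IsFactor u w}.Finite :=
  (List.finite_length_eq A n).subset fun _ h => h.1

theorem finite_P [Finite A] (u : ℕ → A) (n : ℕ) :
    {w : List A | w.length = n ∧ IsFactor u w ∧ w.reverse = w}.Finite :=
  (List.finite_length_eq A n).subset fun _ h => h.1

theorem exists_RS [Finite A] {u : ℕ → A} (h : Aperiodic u) (n : ℕ) :
    ∃ w, w.length = n ∧ RS u w := by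
  by_contra hc
  push Not at hc
  apply h
  have hd : ∀ i j, word u i n = word u j n → u (i + n) = u (j + n) := by
    intro i j hij
    by_contra hne
    refine hc (word u i n) (length_word _ _ _) ⟨_, _, hne, ?_, ?_⟩
    · rw [← word_append]; exact isFactor_word _ _ _
    · rw [hij, ← word_append]; exact isFactor_word _ _ _
  have : ∃ i q, 0 < q ∧ word u i n = word u (i + q) n := by
    obtain ⟨i, -, j, -, hne, he⟩ := Set.infinite_univ.exists_ne_map_eq_of_mapsTo
      (f := fun i : ℕ => word u i n) (t := {w : List A | w.length = n ∧ IsFactor u w})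
      (fun i _ => ⟨length_word _ _ _, isFactor_word _ _ _⟩) (finite_F u n)
    rcases lt_or_gt_of_ne hne with hl | hl
    · exact ⟨i, j - i, by omega, by rw [he]; congr 1; omega⟩
    · exact ⟨j, i - j, by omega, by rw [← he]; congr 1; omega⟩
  obtain ⟨i, q, hq, he⟩ := this
  exact per_of (fun _ => False) i q n hq he (by simp) (fun i j _ => hd i j)

theorem surj_F (u : ℕ → A) (n : ℕ) :
    List.dropLast '' {w : List A | w.length = n + 1 ∧ IsFactor u w} =
      {w : List A | w.length = n ∧ IsFactor u w} := by
  ext w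
  constructor
  · rintro ⟨v, ⟨hl, hf⟩, rfl⟩
    refine ⟨by simp [hl], ?_⟩
    have hv : v ≠ [] := by rintro rfl; simp at hl
    rw [← List.dropLast_append_getLast hv] at hf
    exact f_init hf
  · rintro ⟨hl, hf⟩
    obtain ⟨a, ha⟩ := f_ext hf
    exact ⟨w ++ [a], ⟨by simp [hl], ha⟩, by simp⟩

theorem complexity_zero (u : ℕ → A) : complexity u 0 = 1 := by
  unfold complexity
  rw [Set.ncard_eq_one]
  refine ⟨[], ?_⟩
  ext w
  simp only [Set.mem_ofPred_eq, Set.mem_singleton_iff, List.length_eq_zero_iff]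
  constructor
  · exact fun h => h.1
  · rintro rfl; exact ⟨rfl, isFactor_word u 0 0⟩

theorem lower [Finite A] {u : ℕ → A} (h : Aperiodic u) (n : ℕ) : n + 1 ≤ complexity u n := by
  induction n with
  | zero => rw [complexity_zero]
  | succ n ih =>
    refine Nat.succ_le_of_lt (lt_of_le_of_lt ih ?_)
    by_contra hc
    push Not at hc
    obtain ⟨w, hl, a, b, hne, ha, hb⟩ := exists_RS h n
    have hinj : Set.InjOn List.dropLast {w : List A | w.length = n + 1 ∧ IsFactor u w} := by
      apply Set.injOn_of_ncard_image_eq _ (finite_F u _)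
      rw [surj_F]
      refine le_antisymm ?_ hc
      rw [← surj_F]
      exact Set.ncard_image_le (finite_F u _)
    have := hinj (x₁ := w ++ [a]) (x₂ := w ++ [b]) ⟨by simp [hl], ha⟩ ⟨by simp [hl], hb⟩ (by simp)
    simp at this
    exact hne this

theorem upper_step [Finite A] {u : ℕ → A} (hbin : ∀ a b c : A, a ≠ b → c = a ∨ c = b) {n : ℕ}
    (h : Uniq u n) : complexity u (n + 1) ≤ complexity u n + 1 := by
  by_cases hr : ∃ w, w.length = n ∧ RS u w
  · obtain ⟨w, hl, a, b, hne, ha, hb⟩ := hr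
    set S := {w : List A | w.length = n + 1 ∧ IsFactor u w} with hS
    have hinj : Set.InjOn List.dropLast (S \ {w ++ [b]}) := by
      rintro x ⟨⟨hx, fx⟩, hxb⟩ y ⟨⟨hy, fy⟩, hyb⟩ hxy
      have hx0 : x ≠ [] := by rintro rfl; simp at hx
      have hy0 : y ≠ [] := by rintro rfl; simp at hy
      by_contra hxy'
      have ex := List.dropLast_append_getLast hx0
      have ey := List.dropLast_append_getLast hy0
      rw [← ex] at fx
      rw [← ey, ← hxy] at fy
      have hlne : x.getLast hx0 ≠ y.getLast hy0 := by
        intro hh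
        apply hxy'
        rw [← ex, ← ey, hxy, hh]
      have hw := h x.dropLast w (by simp [hx]) hl ⟨_, _, hlne, fx, fy⟩ ⟨_, _, hne, ha, hb⟩
      rcases hbin _ _ b hlne with hh | hh
      · apply hxb; rw [← ex, hw, hh]; rfl
      · apply hyb; rw [← ey, ← hxy, hw, hh]; rfl
    have h1 : (S \ {w ++ [b]}).ncard ≤ complexity u n := by
      rw [← Set.InjOn.ncard_image hinj]
      unfold complexity
      rw [← surj_F]
      exact Set.ncard_le_ncard (Set.image_mono Set.sdiff_subset) ((finite_F u _).image _)
    have h2 := Set.ncard_le_ncard_sdiff_add_ncard S {w ++ [b]}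
    simp only [Set.ncard_singleton] at h2
    have h3 : complexity u (n + 1) = S.ncard := rfl
    omega
  · push Not at hr
    unfold complexity
    rw [← surj_F u n, Set.InjOn.ncard_image]
    · omega
    · rintro x ⟨hx, fx⟩ y ⟨hy, fy⟩ hxy
      have hx0 : x ≠ [] := by rintro rfl; simp at hx
      have hy0 : y ≠ [] := by rintro rfl; simp at hy
      by_contra hxy'
      have ex := List.dropLast_append_getLast hx0
      have ey := List.dropLast_append_getLast hy0
      rw [← ex] at fx
      rw [← ey, ← hxy] at fy
      have hlne : x.getLast hx0 ≠ y.getLast hy0 := by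
        intro hh
        apply hxy'
        rw [← ex, ← ey, hxy, hh]
      exact hr x.dropLast (by simp [hx]) ⟨_, _, hlne, fx, fy⟩

theorem upper [Finite A] {u : ℕ → A} (hbin : ∀ a b c : A, a ≠ b → c = a ∨ c = b) (n : ℕ)
    (h : ∀ k < n, Uniq u k) : complexity u n ≤ n + 1 := by
  induction n with
  | zero => rw [complexity_zero]
  | succ n ih =>
    have := upper_step hbin (h n (by omega))
    have := ih (fun k hk => h k (by omega))
    omega

theorem uniq_of_complexity [Finite A] {u : ℕ → A} {n : ℕ}
    (h : complexity u (n + 1) ≤ complexity u n + 1) : Uniq u n := by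
  rintro w w' hl hl' ⟨a, b, hne, ha, hb⟩ ⟨a', b', hne', ha', hb'⟩
  by_contra hw
  set S := {w : List A | w.length = n + 1 ∧ IsFactor u w} with hS
  have him : List.dropLast '' (S \ {w ++ [b], w' ++ [b']}) =
      {w : List A | w.length = n ∧ IsFactor u w} := by
    rw [← surj_F]
    apply Set.Subset.antisymm (Set.image_mono Set.sdiff_subset)
    rintro _ ⟨v, hv, rfl⟩
    by_cases h1 : v = w ++ [b]
    · refine ⟨w ++ [a], ⟨⟨by simp [hl], ha⟩, ?_⟩, by simp [h1]⟩
      rintro (h2 | h2)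
      · simp at h2; exact hne h2
      · exact hw (List.append_inj' h2 rfl).1
    · by_cases h1' : v = w' ++ [b']
      · refine ⟨w' ++ [a'], ⟨⟨by simp [hl'], ha'⟩, ?_⟩, by simp [h1']⟩
        rintro (h2 | h2)
        · exact hw (List.append_inj' h2 rfl).1.symm
        · simp at h2; exact hne' h2
      · exact ⟨v, ⟨hv, by simp [h1, h1']⟩, rfl⟩
  have h1 : complexity u n ≤ (S \ {w ++ [b], w' ++ [b']}).ncard := by
    unfold complexity
    rw [← him]
    exact Set.ncard_image_le ((finite_F u _).subset Set.sdiff_subset)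
  have hsub : ({w ++ [b], w' ++ [b']} : Set (List A)) ⊆ S := by
    rintro x (rfl | rfl)
    · exact ⟨by simp [hl], hb⟩
    · exact ⟨by simp [hl'], hb'⟩
  have h2 := Set.ncard_sdiff_add_ncard_of_subset hsub (finite_F u _)
  have hpne : w ++ [b] ≠ w' ++ [b'] := fun h2 => hw (List.append_inj' h2 rfl).1
  rw [Set.ncard_pair hpne] at h2
  have h3 : complexity u (n + 1) = S.ncard := rfl
  omega

theorem recur [Finite A] {u : ℕ → A} (hap : Aperiodic u) {n : ℕ} (hc : complexity u n ≤ n + 1)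
    {w : List A} (hl : w.length = n) (hf : IsFactor u w) : ∃ a, IsFactor u (a :: w) := by
  have hap' : Aperiodic (fun i => u (i + 1)) := by
    rintro ⟨p, hp, N, h⟩
    refine hap ⟨p, hp, N + 1, fun k hk => ?_⟩
    have := h (k - 1) (by omega)
    simp only at this
    rw [show k - 1 + p + 1 = k + p by omega, show k - 1 + 1 = k by omega] at this
    exact this
  have hw : ∀ i, word (fun i => u (i + 1)) i n = word u (i + 1) n := by
    intro i
    simp only [word]
    apply List.map_congr_left
    intro j _
    congr 1
    omega
  have hlow := lower hap' n
  have hsub : {w : List A | w.length = n ∧ IsFactor (fun i => u (i + 1)) w} ⊆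
      {w : List A | w.length = n ∧ IsFactor u w} := by
    rintro v ⟨hv, fv⟩
    obtain ⟨i, rfl⟩ := exists_word fv hv
    rw [hw]
    exact ⟨length_word _ _ _, isFactor_word _ _ _⟩
  have heq := Set.eq_of_subset_of_ncard_le hsub (by unfold complexity at *; omega) (finite_F u n)
  have hmem : w ∈ {w : List A | w.length = n ∧ IsFactor u w} := ⟨hl, hf⟩
  rw [← heq] at hmem
  obtain ⟨i, hi⟩ := exists_word hmem.2 hl
  refine ⟨u i, ?_⟩
  rw [hi, hw, ← word_cons]
  exact isFactor_word _ _ _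

theorem aper_of_complexity [Finite A] {u : ℕ → A} (h : ∀ n, complexity u n = n + 1) :
    Aperiodic u := by
  rintro ⟨p, hp, N, hN⟩
  have hper : ∀ i n, word u (N + i + p) n = word u (N + i) n := by
    intro i n
    simp only [word]
    apply List.map_congr_left
    intro j _
    rw [show N + i + p + j = N + i + j + p by omega]
    exact hN _ (by omega)
  have hall : ∀ n i, ∃ j < N + p, word u i n = word u j n := by
    intro n i
    induction i using Nat.strong_induction_on with
    | _ i ih =>
      by_cases hi : i < N + p
      · exact ⟨i, hi, rfl⟩
      · obtain ⟨j, hj, e⟩ := ih (i - p) (by omega)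
        refine ⟨j, hj, ?_⟩
        rw [← e]
        have := hper (i - p - N) n
        rw [show N + (i - p - N) + p = i by omega, show N + (i - p - N) = i - p by omega] at this
        exact this
  have h1 := h (N + p)
  have hsub : {w : List A | w.length = N + p ∧ IsFactor u w} ⊆
      (fun i => word u i (N + p)) '' (Set.Iio (N + p)) := by
    rintro v ⟨hv, fv⟩
    obtain ⟨i, rfl⟩ := exists_word fv hv
    obtain ⟨j, hj, e⟩ := hall (N + p) i
    exact ⟨j, hj, e.symm⟩
  have h2 := Set.ncard_le_ncard hsub ((Set.finite_Iio _).image _)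
  have h3 := Set.ncard_image_le (f := fun i => word u i (N + p)) (Set.finite_Iio (N + p))
  have h4 : (Set.Iio (N + p)).ncard = N + p := by
    rw [Set.ncard_eq_toFinset_card']; simp
  unfold complexity at h1
  omega

/-- everything known at level `n` -/
structure Lev (u : ℕ → A) (n : ℕ) : Prop where
  uniq : ∀ k ≤ n, Uniq u k
  closed : Closed u (n + 1)

theorem Lev.rec1 [Finite A] {u : ℕ → A} (hbin : ∀ a b c : A, a ≠ b → c = a ∨ c = b)
    (hap : Aperiodic u) {n : ℕ} (hL : Lev u n) {w : List A} (hl : w.length = n + 1) (hf : IsFactor u w) :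
    ∃ a, IsFactor u (a :: w) :=
  recur hap (upper hbin (n + 1) (fun k hk => hL.uniq k (by omega))) hl hf

theorem Lev.revl {u : ℕ → A} {n : ℕ} (hL : Lev u n) {w : List A} {a : A} (hl : w.length = n) (h : IsFactor u (a :: w)) :
    IsFactor u (w.reverse ++ [a]) := by
  simpa using hL.closed (a :: w) (by simp [hl]) h

theorem Lev.revr {u : ℕ → A} {n : ℕ} (hL : Lev u n) {w : List A} {a : A} (hl : w.length = n) (h : IsFactor u (w ++ [a])) :
    IsFactor u (a :: w.reverse) := by
  simpa using hL.closed (w ++ [a]) (by simp [hl]) h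

/-- a right special word of length `n` has a right special left extension -/
theorem Lev.rsext [Finite A] {u : ℕ → A} (hbin : ∀ a b c : A, a ≠ b → c = a ∨ c = b)
    (hap : Aperiodic u) {n : ℕ} (hL : Lev u n) {w : List A} (hl : w.length = n) (h : RS u w) : ∃ z, ∀ y,
    IsFactor u (z :: (w ++ [y])) := by
  obtain ⟨v, hv, a, b, hne, ha, hb⟩ := exists_RS hap (n + 1)
  rcases v with _ | ⟨z, v⟩
  · simp at hv
  have : v = w := hL.uniq n le_rfl v w (by simpa using hv) hl ⟨a, b, hne, f_tail ha, f_tail hb⟩ h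
  subst this
  refine ⟨z, fun y => ?_⟩
  rcases hbin a b y hne with rfl | rfl
  · exact ha
  · exact hb

theorem Lev.palext [Finite A] {u : ℕ → A} (hbin : ∀ a b c : A, a ≠ b → c = a ∨ c = b)
    (hap : Aperiodic u) {n : ℕ} (hL : Lev u n) {w : List A} (hl : w.length = n) (hf : IsFactor u w) (hp : w.reverse = w) :
    ∃ z, IsFactor u (z :: (w ++ [z])) := by
  by_cases hr : RS u w
  · obtain ⟨z, hz⟩ := hL.rsext hbin hap hl hr
    exact ⟨z, hz z⟩
  · obtain ⟨y, hy⟩ := f_ext hf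
    obtain ⟨z, hz⟩ := hL.rec1 hbin hap (by simp [hl]) hy
    have h1 : IsFactor u (z :: w) := f_init (a := y) hz
    have h2 := hL.revl hl h1
    rw [hp] at h2
    have : z = y := by
      by_contra hne
      exact hr ⟨z, y, hne, h2, hy⟩
    subst this
    exact ⟨z, hz⟩

theorem Lev.next [Finite A] {u : ℕ → A} (hbin : ∀ a b c : A, a ≠ b → c = a ∨ c = b)
    (hap : Aperiodic u) {n : ℕ} (hL : Lev u n) (hg : Good u n) : Lev u (n + 1) := by
  constructor
  · intro k hk
    rcases Nat.lt_or_ge n k with hk' | hk'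
    · obtain rfl : k = n + 1 := by omega
      rintro v v' hv hv' ⟨a, b, hne, ha, hb⟩ ⟨a', b', hne', ha', hb'⟩
      rcases v with _ | ⟨x, w⟩
      · simp at hv
      rcases v' with _ | ⟨x', w'⟩
      · simp at hv'
      simp only [List.length_cons, Nat.add_right_cancel_iff] at hv hv'
      have hr : RS u w := ⟨a, b, hne, f_tail ha, f_tail hb⟩
      have : w' = w := hL.uniq n le_rfl w' w hv' hv ⟨a', b', hne', f_tail ha', f_tail hb'⟩ hr
      subst this
      by_contra hxx
      have hxx' : x ≠ x' := by rintro rfl; exact hxx rfl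
      have h1 := hL.revl hv (f_init (w := x :: w') ha)
      have h2 := hL.revl hv (f_init (w := x' :: w') ha')
      have hp := hL.uniq n le_rfl w'.reverse w' (by simpa using hv) hv ⟨x, x', hxx', h1, h2⟩ hr
      have e1 : IsFactor u (x :: (w' ++ [x])) := by
        rcases hbin a b x hne with h | h
        · rw [← h] at ha; exact ha
        · rw [← h] at hb; exact hb
      have e2 : IsFactor u (x' :: (w' ++ [x'])) := by
        rcases hbin a' b' x' hne' with h | h
        · rw [← h] at ha'; exact ha'
        · rw [← h] at hb'; exact hb'
      exact hxx' (hg w' x x' hv hp e1 e2)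
    · exact hL.uniq k hk'
  · intro v hv hf
    rcases v with _ | ⟨x, v⟩
    · simp at hv
    rcases List.eq_nil_or_concat v with rfl | ⟨w, y, rfl⟩
    · simp at hv
    simp only [List.concat_eq_append, List.length_cons, List.length_append, List.length_nil] at hv
    have hl : w.length = n := by omega
    simp only [List.concat_eq_append] at hf
    have hgoal : IsFactor u (y :: (w.reverse ++ [x])) := by
      have hxw : IsFactor u (x :: w) := f_init (a := y) hf
      have hwy : IsFactor u (w ++ [y]) := f_tail hf
      have hlr : w.reverse.length = n := by simpa using hl
      by_cases hr : RS u w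
      · by_cases hr' : RS u w.reverse
        · have hp := hL.uniq n le_rfl _ _ hlr hl hr' hr
          rw [hp]
          by_cases hxy : x = y
          · subst hxy; exact hf
          · obtain ⟨z, hz⟩ := hL.rsext hbin hap hl hr
            rcases hbin x y z hxy with h | h
            · subst h
              obtain ⟨a, b, hne, ha, hb⟩ := hr
              have hwy' : IsFactor u (y :: w) := by
                have := hL.revr hl hwy
                rwa [hp] at this
              obtain ⟨c, hc⟩ := f_ext hwy'
              rcases hbin z y c hxy with h | h
              · subst h; exact hc
              · subst h
                exact absurd (hg w z c hl hp (hz z) hc) hxy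
            · subst h; exact hz x
        · have h1 := hL.revr hl hwy
          obtain ⟨z, hz⟩ := f_ext h1
          have h2 : IsFactor u (w.reverse ++ [z]) := f_tail (a := y) hz
          have h3 := hL.revl hl hxw
          have : z = x := by
            by_contra hne
            exact hr' ⟨z, x, hne, h2, h3⟩
          subst this
          exact hz
      · have h1 := hL.revl hl hxw
        obtain ⟨z, hz⟩ := hL.rec1 hbin hap (by simp [hl]) h1
        have h2 : IsFactor u (z :: w.reverse) := f_init (a := x) hz
        have h3 := hL.revl hlr h2
        rw [List.reverse_reverse] at h3
        have : z = y := by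
          by_contra hne
          exact hr ⟨z, y, hne, h3, hwy⟩
        subst this
        exact hz
    simpa using hgoal

def strip (w : List A) : List A := w.tail.dropLast

theorem pal_form {n : ℕ} {v : List A} (hv : v.length = n + 2) (hp : v.reverse = v) :
    ∃ a w, v = a :: (w ++ [a]) ∧ w.length = n ∧ w.reverse = w := by
  rcases v with _ | ⟨x, v⟩
  · simp at hv
  rcases List.eq_nil_or_concat v with rfl | ⟨w, y, rfl⟩
  · simp at hv
  simp at hp hv
  obtain ⟨rfl, hp⟩ := hp
  refine ⟨y, w, by simp, by omega, ?_⟩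
  exact hp.1

theorem Lev.pal_image [Finite A] {u : ℕ → A} (hbin : ∀ a b c : A, a ≠ b → c = a ∨ c = b)
    (hap : Aperiodic u) {n : ℕ} (hL : Lev u n) : strip ''
    {w : List A | w.length = n + 2 ∧ IsFactor u w ∧ w.reverse = w} =
    {w : List A | w.length = n ∧ IsFactor u w ∧ w.reverse = w} := by
  ext w
  constructor
  · rintro ⟨v, ⟨hv, fv, hp⟩, rfl⟩
    obtain ⟨a, w, rfl, hl, hr⟩ := pal_form hv hp
    have : strip (a :: (w ++ [a])) = w := by simp [strip]
    rw [this]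
    exact ⟨hl, f_init (f_tail fv), hr⟩
  · rintro ⟨hl, hf, hp⟩
    obtain ⟨z, hz⟩ := hL.palext hbin hap hl hf hp
    exact ⟨_, ⟨by simp [hl], hz, by simp [hp]⟩, by simp [strip]⟩

theorem Lev.pal_eq [Finite A] {u : ℕ → A} (hbin : ∀ a b c : A, a ≠ b → c = a ∨ c = b)
    (hap : Aperiodic u) {n : ℕ} (hL : Lev u n) (hg : Good u n) : palComplexity u (n + 2) = palComplexity u n := by
  unfold palComplexity
  rw [← hL.pal_image hbin hap, Set.InjOn.ncard_image]
  rintro x ⟨hx, fx, px⟩ y ⟨hy, fy, py⟩ hxy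
  obtain ⟨a, w, rfl, hl, hr⟩ := pal_form hx px
  obtain ⟨b, w', rfl, hl', hr'⟩ := pal_form hy py
  simp only [strip, List.tail_cons, List.dropLast_concat] at hxy
  subst hxy
  rw [hg w a b hl hr fx fy]

theorem Lev.good_of_pal [Finite A] {u : ℕ → A} (hbin : ∀ a b c : A, a ≠ b → c = a ∨ c = b)
    (hap : Aperiodic u) {n : ℕ} (hL : Lev u n) (h : palComplexity u (n + 2) = palComplexity u n) : Good u n := by
  intro w a b hl hr fa fb
  have hinj : Set.InjOn strip {w : List A | w.length = n + 2 ∧ IsFactor u w ∧ w.reverse = w} := by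
    apply Set.injOn_of_ncard_image_eq _ (finite_P u _)
    rw [hL.pal_image hbin hap]
    exact h.symm
  have := hinj (x₁ := a :: (w ++ [a])) (x₂ := b :: (w ++ [b])) ⟨by simp [hl], fa, by simp [hr]⟩
    ⟨by simp [hl], fb, by simp [hr]⟩ (by simp [strip])
  exact (List.cons.inj this).1

theorem Lev.good_aux [Finite A] {u : ℕ → A}
    (hap : Aperiodic u) {n : ℕ} (hc : complexity u (n + 1) = n + 2) (hU : Uniq u (n + 1))
    {w : List A} {a b : A} (hl : w.length = n) (hp : w.reverse = w) (hne : a ≠ b)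
    (hz : ∀ y, IsFactor u (a :: (w ++ [y]))) (fb : IsFactor u (b :: (w ++ [b]))) : False := by
  obtain ⟨i, hi⟩ := exists_word fb (by simp [hl] : _ = n + 2)
  have hra : RS u (a :: w) := ⟨a, b, hne, hz a, hz b⟩
  have ub : u i = b := by
    rw [word_cons] at hi
    exact (List.cons.inj hi).1.symm
  rw [word_cons, word_append] at hi
  have hi2 := (List.cons.inj hi).2
  have hw : w = word u (i + 1) n := (List.append_inj' hi2 rfl).1
  have ub2 : u (i + 1 + n) = b := by
    have := (List.append_inj' hi2 rfl).2
    simpa using this.symm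
  have hsym : ∀ m m', m + m' + 1 = n → u (i + 1 + m) = u (i + 1 + m') := by
    intro m m' hm
    have h1 : w[m]'(by omega) = u (i + 1 + m) := by
      simp only [hw, getElem_word]
    have h2 : w[m']'(by omega) = u (i + 1 + m') := by
      simp only [hw, getElem_word]
    have h3 : w.reverse[m]'(by simp; omega) = w[m']'(by omega) := by
      rw [List.getElem_reverse]; congr 1; omega
    rw [← h1, ← h2, ← h3]
    simp only [hp]
  have hnot : ∀ j ≤ n + 1, word u (i + j) (n + 1) ≠ a :: w := by
    intro j hj he
    rw [word_cons] at he
    obtain ⟨h1, h2⟩ := List.cons.inj he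
    rcases j with _ | j
    · exact hne (h1.symm.trans ub)
    · rcases Nat.lt_or_ge j n with hjn | hjn
      · have h3 : u (i + (j + 1) + 1 + (n - 1 - j)) = u (i + 1 + (n - 1 - j)) := by
          have e1 : w[n - 1 - j]'(by omega) = u (i + 1 + (n - 1 - j)) := by
            simp only [hw, getElem_word]
          have e2 : w[n - 1 - j]'(by omega) = u (i + (j + 1) + 1 + (n - 1 - j)) := by
            simp only [← h2, getElem_word]
          rw [← e1, ← e2]
        rw [hsym (n - 1 - j) j (by omega), show i + (j + 1) + 1 + (n - 1 - j) = i + 1 + n by omega,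
          ub2, show i + 1 + j = i + (j + 1) by omega, h1] at h3
        exact hne h3.symm
      · obtain rfl : j = n := by omega
        rw [show i + (j + 1) = i + 1 + j by omega, ub2] at h1
        exact hne h1.symm
  have hdet : ∀ i' j', ¬ (word u i' (n + 1) = a :: w) → word u i' (n + 1) = word u j' (n + 1) →
      u (i' + (n + 1)) = u (j' + (n + 1)) := by
    intro i' j' h1 h2
    by_contra h3
    apply h1
    refine hU _ _ (length_word _ _ _) (by simp [hl]) ⟨_, _, h3, ?_, ?_⟩ hra
    · rw [← word_append]; exact isFactor_word _ _ _
    · rw [h2, ← word_append]; exact isFactor_word _ _ _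
  have hcol : ∃ j j', j < j' ∧ j' ≤ n + 1 ∧ word u (i + j) (n + 1) = word u (i + j') (n + 1) := by
    set S := {w : List A | w.length = n + 1 ∧ IsFactor u w} with hS
    have hcard : (S \ {a :: w}).ncard < (Set.Iio (n + 2)).ncard := by
      have h1 : (Set.Iio (n + 2)).ncard = n + 2 := by
        rw [Set.ncard_eq_toFinset_card']; simp
      have h2 : (S \ {a :: w}).ncard < S.ncard :=
        Set.ncard_sdiff_singleton_lt_of_mem ⟨by simp [hl], f_init (w := a :: w) (hz a)⟩ (finite_F u _)
      have h3 : complexity u (n + 1) = S.ncard := rfl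
      omega
    obtain ⟨j, hj, j', hj', hjj, he⟩ := Set.exists_ne_map_eq_of_ncard_lt_of_maps_to hcard
      (f := fun j => word u (i + j) (n + 1))
      (fun j hj => ⟨⟨length_word _ _ _, isFactor_word _ _ _⟩, hnot j (Nat.le_of_lt_succ hj)⟩)
      ((finite_F u _).subset Set.sdiff_subset)
    simp only [Set.mem_Iio] at hj hj' he
    rcases lt_or_gt_of_ne hjj with h | h
    · exact ⟨j, j', h, by omega, he⟩
    · exact ⟨j', j, h, by omega, he.symm⟩
  obtain ⟨j, j', hlt, hle, he⟩ := hcol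
  refine hap (per_of (fun v => v = a :: w) (i + j) (j' - j) (n + 1) (by omega) ?_ ?_ hdet)
  · rw [he]; congr 1; omega
  · intro k hk
    rw [show i + j + k = i + (j + k) by omega]
    exact hnot _ (by omega)

theorem Lev.good_of_complexity [Finite A] {u : ℕ → A} (hbin : ∀ a b c : A, a ≠ b → c = a ∨ c = b)
    (hap : Aperiodic u) {n : ℕ} (hL : Lev u n) (hc : complexity u (n + 1) = n + 2) (hU : Uniq u (n + 1)) :
    Good u n := by
  intro w a b hl hp fa fb
  by_contra hne
  have hr : RS u w := ⟨a, b, hne, f_tail fa, f_tail fb⟩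
  obtain ⟨z, hz⟩ := hL.rsext hbin hap hl hr
  rcases hbin a b z hne with h | h
  · subst h
    exact Lev.good_aux hap hc hU hl hp hne hz fb
  · subst h
    exact Lev.good_aux hap hc hU hl hp (Ne.symm hne) hz fa

theorem lev_zero (u : ℕ → A) : Lev u 0 := by
  constructor
  · intro k hk w w' h h' _ _
    obtain rfl : k = 0 := by omega
    rw [List.length_eq_zero_iff] at h h'
    rw [h, h']
  · intro w hw hf
    obtain ⟨a, rfl⟩ := List.length_eq_one_iff.1 hw
    exact hf

theorem pal_zero (u : ℕ → A) : palComplexity u 0 = 1 := by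
  unfold palComplexity
  rw [Set.ncard_eq_one]
  refine ⟨[], ?_⟩
  ext w
  simp only [Set.mem_ofPred_eq, Set.mem_singleton_iff, List.length_eq_zero_iff]
  constructor
  · exact fun h => h.1
  · rintro rfl; exact ⟨rfl, isFactor_word u 0 0, rfl⟩

theorem pal_one [Fintype A] (u : ℕ → A) (hcard : Fintype.card A = 2) (hall : AllLettersOccur u) :
    palComplexity u 1 = 2 := by
  unfold palComplexity
  have : {w : List A | w.length = 1 ∧ IsFactor u w ∧ w.reverse = w} =
      (fun a : A => [a]) '' Set.univ := by
    ext w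
    constructor
    · rintro ⟨h, _⟩
      obtain ⟨a, rfl⟩ := List.length_eq_one_iff.1 h
      exact ⟨a, trivial, rfl⟩
    · rintro ⟨a, -, rfl⟩
      obtain ⟨i, hi⟩ := hall a
      refine ⟨rfl, ⟨i, ?_⟩, rfl⟩
      simp [OccursAt, word, hi]
  rw [this, Set.ncard_image_of_injective _ (fun a b h => by simpa using h), Set.ncard_univ,
    Nat.card_eq_fintype_card, hcard]

/-- structure of long palindromes in an eventually periodic word -/
theorem pal_periodic {u : ℕ → A} {v : ℤ → A} {p N : ℕ} (hp : 0 < p)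
    (hv : ∀ z, v (z + p) = v z) (huv : ∀ n : ℕ, N ≤ n → u n = v n)
    {l i : ℕ} (hl : 2 * N + p ≤ l) (hpal : (word u i l).reverse = word u i l) :
    (∀ z, v (2 * i + l - 1 - z) = v z) ∧ ∀ j : ℕ, j < l → u (i + j) = v ((i : ℤ) + j) := by
  have hsym : ∀ j j', j + j' + 1 = l → u (i + j) = u (i + j') := by
    intro j j' h
    have h1 : (word u i l).reverse[j]'(by simp [length_word]; omega) = u (i + j') := by
      rw [List.getElem_reverse, getElem_word, length_word]; congr 1; omega
    rw [← h1]
    simp only [hpal, getElem_word]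
  have hmul : ∀ (k : ℤ) z, v (z + k * p) = v z := by
    intro k
    induction k using Int.induction_on with
    | zero => simp
    | succ k ih => intro z; rw [← ih z, ← hv (z + k * p)]; congr 1; ring
    | pred k ih => intro z; rw [← ih z, ← hv (z + (-k - 1) * p)]; congr 1; ring
  have hs : ∀ z, v (2 * i + l - 1 - z) = v z := by
    intro z
    set r : ℤ := (z - (i + N)) % p with hr
    have hr0 : 0 ≤ r := Int.emod_nonneg _ (by omega)
    have hr1 : r < p := Int.emod_lt_of_pos _ (by omega)
    have hdiv : (z - (i + N)) = r + ((z - (i + N)) / p) * p := by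
      rw [hr, mul_comm]; exact (Int.emod_add_mul_ediv _ _).symm
    set k := (z - (i + N)) / p
    have hz : z = (i + N + r) + k * p := by linarith
    obtain ⟨m, hm⟩ := Int.eq_ofNat_of_zero_le hr0
    have e1 : v z = u (i + (N + m)) := by
      rw [hz, hmul, huv _ (by omega)]; congr 1; push_cast; rw [hm]; ring
    have e2 : v (2 * i + l - 1 - z) = u (i + (l - 1 - (N + m))) := by
      rw [huv _ (by omega), ← hmul k]
      congr 1
      rw [hz, hm]
      have : ((l - 1 - (N + m) : ℕ) : ℤ) = l - 1 - (N + m) := by omega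
      push_cast [this]
      ring
    rw [e1, e2]
    exact hsym _ _ (by omega)
  refine ⟨hs, fun j hj => ?_⟩
  by_cases hjN : N ≤ j
  · rw [huv _ (by omega)]; push_cast; rfl
  · rw [hsym j (l - 1 - j) (by omega), huv _ (by omega), ← hs]
    congr 1
    have : ((l - 1 - j : ℕ) : ℤ) = l - 1 - j := by omega
    push_cast [this]
    ring

theorem aper_of_pal [Finite A] {u : ℕ → A} (he : ∀ n, Even n → palComplexity u n = 1)
    (ho : ∀ n, Odd n → palComplexity u n = 2) : Aperiodic u := by
  rintro ⟨p, hp, N, hN⟩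
  -- biinfinite periodic extension
  set v : ℤ → A := fun z => u (N + ((z - N) % p).toNat) with hvdef
  have hv : ∀ z, v (z + p) = v z := by
    intro z
    simp only [hvdef]
    rw [show z + p - N = z - N + p by ring, Int.add_emod_right]
  have hNk : ∀ k n, N ≤ n → u (n + p * k) = u n := by
    intro k
    induction k with
    | zero => simp
    | succ k ih => intro n hn; rw [← ih n hn, ← hN _ (by omega : N ≤ n + p * k)]; congr 1; ring
  have huv : ∀ n : ℕ, N ≤ n → u n = v n := by
    intro n hn
    simp only [hvdef]
    have : (((n : ℤ) - N) % p).toNat = (n - N) % p := by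
      rw [← Nat.cast_sub hn]; norm_cast
    rw [this, ← hNk ((n - N) / p) (N + (n - N) % p) (by omega)]
    congr 1
    have := Nat.mod_add_div (n - N) p
    omega
  set r := N + p with hrdef
  obtain ⟨w0, hw0⟩ := Set.ncard_eq_one.1 (he (2 * r) (by simp))
  have hm0 : w0 ∈ {w : List A | w.length = 2 * r ∧ IsFactor u w ∧ w.reverse = w} := by
    rw [hw0]; rfl
  obtain ⟨w1, w2, hne, hw12⟩ := Set.ncard_eq_two.1 (ho (2 * r + 1) (by simp))
  have hm1 : w1 ∈ {w : List A | w.length = 2 * r + 1 ∧ IsFactor u w ∧ w.reverse = w} := by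
    rw [hw12]; simp
  have hm2 : w2 ∈ {w : List A | w.length = 2 * r + 1 ∧ IsFactor u w ∧ w.reverse = w} := by
    rw [hw12]; simp
  obtain ⟨i0, rfl⟩ := exists_word hm0.2.1 hm0.1
  obtain ⟨i1, rfl⟩ := exists_word hm1.2.1 hm1.1
  obtain ⟨i2, rfl⟩ := exists_word hm2.2.1 hm2.1
  obtain ⟨s0, -⟩ := pal_periodic hp hv huv (by omega) hm0.2.2
  obtain ⟨s1, f1⟩ := pal_periodic hp hv huv (by omega) hm1.2.2
  obtain ⟨s2, f2⟩ := pal_periodic hp hv huv (by omega) hm2.2.2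
  set q : ℤ := i0 - i1 - 1 with hq
  have hT1 : ∀ z, v (z + (2 * q + 1)) = v z := by
    intro z
    rw [← s1 z, ← s0]
    congr 1
    push_cast
    rw [hq]; ring
  set e : ℤ := i2 - i1 with hedef
  have hT2 : ∀ z, v (z + 2 * e) = v z := by
    intro z
    rw [← s1 z, ← s2]
    congr 1
    push_cast
    rw [hedef]; ring
  have hmul : ∀ t : ℤ, (∀ z, v (z + t) = v z) → ∀ (k : ℤ) z, v (z + k * t) = v z := by
    intro t ht k
    induction k using Int.induction_on with
    | zero => simp
    | succ k ih => intro z; rw [← ih z, ← ht (z + k * t)]; congr 1; ring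
    | pred k ih => intro z; rw [← ih z, ← ht (z + (-k - 1) * t)]; congr 1; ring
  have hT : ∀ z, v (z + e) = v z := by
    intro z
    rw [← hmul _ hT2 q (z + e), ← hmul _ hT1 e z]
    congr 1
    ring
  apply hne
  apply List.ext_getElem
  · simp [length_word]
  · intro k h1 h2
    rw [length_word] at h1
    rw [getElem_word, getElem_word, f1 k (by omega), f2 k (by omega), ← hT]
    congr 1
    rw [hedef]; ring

theorem main_equiv [Fintype A] (u : ℕ → A) (hcard : Fintype.card A = 2)
    (hall : AllLettersOccur u) :
    (∀ n : ℕ, complexity u n = n + 1) ↔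
      (∀ n : ℕ, (Even n → palComplexity u n = 1) ∧ (Odd n → palComplexity u n = 2)) := by
  have hbin : ∀ a b c : A, a ≠ b → c = a ∨ c = b := by
    classical
    intro a b c hab
    by_contra hc
    push Not at hc
    have := Finset.card_le_univ ({c, a, b} : Finset A)
    rw [Finset.card_insert_of_notMem (by simp [hc.1, hc.2]), Finset.card_pair hab, hcard] at this
    omega
  constructor
  · intro h
    have hap := aper_of_complexity h
    have hU : ∀ n, Uniq u n := fun n => uniq_of_complexity (by rw [h, h])
    have hL : ∀ n, Lev u n := by
      intro n
      induction n with
      | zero => exact lev_zero u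
      | succ n ih => exact ih.next hbin hap (ih.good_of_complexity hbin hap (h _) (hU _))
    have hP : ∀ n, palComplexity u (n + 2) = palComplexity u n := fun n =>
      (hL n).pal_eq hbin hap ((hL n).good_of_complexity hbin hap (h _) (hU _))
    intro n
    constructor
    · rintro ⟨k, rfl⟩
      induction k with
      | zero => exact pal_zero u
      | succ k ih => rw [show k + 1 + (k + 1) = k + k + 2 by ring, hP]; exact ih
    · rintro ⟨k, rfl⟩
      induction k with
      | zero => exact pal_one u hcard hall
      | succ k ih => rw [show 2 * (k + 1) + 1 = 2 * k + 1 + 2 by ring, hP]; exact ih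
  · intro h
    have hap : Aperiodic u := aper_of_pal (fun n => (h n).1) (fun n => (h n).2)
    have hP : ∀ n, palComplexity u (n + 2) = palComplexity u n := by
      intro n
      rcases Nat.even_or_odd n with hn | hn
      · rw [(h n).1 hn, (h (n + 2)).1 (by simpa [Nat.even_add] using hn)]
      · rw [(h n).2 hn, (h (n + 2)).2 (by simpa [Nat.odd_add] using hn)]
    have hL : ∀ n, Lev u n := by
      intro n
      induction n with
      | zero => exact lev_zero u
      | succ n ih => exact ih.next hbin hap (ih.good_of_pal hbin hap (hP n))
    intro n
    exact le_antisymm (upper hbin n (fun k _ => (hL k).uniq k le_rfl)) (lower hap n)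

theorem pal_equiv (u : ℕ → A) :
    (∀ n : ℕ, palComplexity u n + palComplexity u (n + 1) = 3) ↔
      (∀ n : ℕ, (Even n → palComplexity u n = 1) ∧ (Odd n → palComplexity u n = 2)) := by
  constructor
  · intro h n
    induction n with
    | zero => exact ⟨fun _ => pal_zero u, fun h => by simp at h⟩
    | succ n ih =>
      have := h n
      constructor
      · intro hn
        have := ih.2 (by simpa [Nat.even_add_one] using hn)
        omega
      · intro hn
        have := ih.1 (by simpa [Nat.odd_add_one] using hn)
        omega
  · intro h n
    rcases Nat.even_or_odd n with hn | hn
    · rw [(h n).1 hn, (h (n + 1)).2 hn.add_one]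
    · rw [(h n).2 hn, (h (n + 1)).1 hn.add_one]

end helpers

/-- A binary infinite word is Sturmian iff `P(n) + P(n+1) = 3`
for all `n`; equivalently, iff it contains exactly one palindromic factor of
every even length and exactly two of every odd length. -/
theorem stmt12 {A : Type*} [Fintype A] (u : ℕ → A)
    (hcard : Fintype.card A = 2)
    (hall : AllLettersOccur u) :
    ((∀ n : ℕ, complexity u n = n + 1) ↔
      (∀ n : ℕ, palComplexity u n + palComplexity u (n + 1) = 3)) ∧
    ((∀ n : ℕ, complexity u n = n + 1) ↔
      (∀ n : ℕ, (Even n → palComplexity u n = 1) ∧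
        (Odd n → palComplexity u n = 2))) := by
  have h := main_equiv u hcard hall
  exact ⟨h.trans (pal_equiv u).symm, h⟩
end

section
/- Let u be an infinite word over a finite alphabet A with k = #A letters, and suppose u has no weak bispecial factors (every bispecial factor w satisfies b(w) ≥ 0). Then every factor of u has exactly k return words if and only if u is uniformly recurrent and its factor complexity satisfies C(n) = (k−1)n + 1 for all n ∈ ℕ. -/
open List

namespace RW
open Classical

variable {A : Type*}

theorem word_length (u : ℕ → A) (i n : ℕ) : (word u i n).length = n := by
  simp [word]

theorem word_add (u : ℕ → A) (i m n : ℕ) :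
    word u i (m + n) = word u i m ++ word u (i + m) n := by
  simp [word, List.range_add, Function.comp_def, add_assoc]

theorem word_occurs (u : ℕ → A) (i n : ℕ) : OccursAt u (word u i n) i := by
  simp [OccursAt, word_length]

theorem word_one (u : ℕ → A) (i : ℕ) : word u i 1 = [u i] := by
  simp [word]

theorem word_zero (u : ℕ → A) (i : ℕ) : word u i 0 = [] := by
  simp [word]

theorem word_succ_cons (u : ℕ → A) (i n : ℕ) :
    word u i (n + 1) = u i :: word u (i + 1) n := by
  rw [add_comm, word_add, word_one]; rfl

theorem word_succ_snoc (u : ℕ → A) (i n : ℕ) :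
    word u i (n + 1) = word u i n ++ [u (i + n)] := by
  rw [word_add, word_one]

theorem isFactor_word (u : ℕ → A) (i n : ℕ) : IsFactor u (word u i n) := ⟨i, word_occurs u i n⟩

theorem occursAt_append (u : ℕ → A) (x y : List A) (i : ℕ) :
    OccursAt u (x ++ y) i ↔ OccursAt u x i ∧ OccursAt u y (i + x.length) := by
  unfold OccursAt
  rw [List.length_append, word_add]
  constructor
  · intro h
    exact List.append_inj h (by simp [word_length])
  · rintro ⟨h1, h2⟩
    rw [← h1, ← h2]

theorem occursAt_cons (u : ℕ → A) (a : A) (y : List A) (i : ℕ) :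
    OccursAt u (a :: y) i ↔ a = u i ∧ OccursAt u y (i + 1) := by
  unfold OccursAt
  rw [List.length_cons, word_succ_cons, List.cons.injEq]

theorem prefix_word (u : ℕ → A) (w : List A) (i n : ℕ) :
    w <+: word u i n ↔ w.length ≤ n ∧ OccursAt u w i := by
  constructor
  · rintro ⟨t, ht⟩
    have h1 := word_occurs u i n
    rw [← ht, occursAt_append] at h1
    have h2 := congrArg List.length ht
    rw [word_length, List.length_append] at h2
    exact ⟨by omega, h1.1⟩
  · rintro ⟨h1, h2⟩
    obtain ⟨d, rfl⟩ := Nat.exists_eq_add_of_le h1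
    rw [word_add, ← h2]
    exact List.prefix_append _ _

theorem infix_word (u : ℕ → A) (w : List A) (i n : ℕ) :
    w <:+: word u i n ↔ ∃ j, j + w.length ≤ n ∧ OccursAt u w (i + j) := by
  constructor
  · rintro ⟨s, t, ht⟩
    have h1 := word_occurs u i n
    rw [← ht, occursAt_append, occursAt_append] at h1
    have h2 := congrArg List.length ht
    rw [word_length, List.length_append, List.length_append] at h2
    exact ⟨s.length, by omega, h1.1.2⟩
  · rintro ⟨j, h1, h2⟩
    obtain ⟨d, rfl⟩ := Nat.exists_eq_add_of_le h1
    refine ⟨word u i j, word u (i + (j + w.length)) d, ?_⟩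
    rw [word_add, word_add, ← h2]

/-- `x` starts with `w` and has no other occurrence of `w`. -/
def T (w x : List A) : Prop :=
  w <+: x ∧ ∀ a y, x = a :: y → ¬ w <:+: y

theorem T_word (u : ℕ → A) (w : List A) (i n : ℕ) :
    T w (word u i n) ↔ w.length ≤ n ∧ OccursAt u w i ∧
      ∀ j, 0 < j → j + w.length ≤ n → ¬ OccursAt u w (i + j) := by
  unfold T
  rw [prefix_word]
  cases n with
  | zero =>
    simp only [word_zero]
    constructor
    · rintro ⟨⟨h1, h2⟩, -⟩
      exact ⟨h1, h2, fun j h3 h4 => by omega⟩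
    · rintro ⟨h1, h2, -⟩
      exact ⟨⟨h1, h2⟩, by simp⟩
  | succ n =>
    rw [word_succ_cons]
    simp only [List.cons.injEq, and_imp, and_assoc]
    refine and_congr_right fun _ => and_congr_right fun _ => ?_
    constructor
    · intro h j hj hn ho
      refine h _ _ rfl rfl ((infix_word _ _ _ _).2 ⟨j - 1, by omega, ?_⟩)
      convert ho using 1
      omega
    · rintro h a y rfl rfl hi
      obtain ⟨j, h1, h2⟩ := (infix_word _ _ _ _).1 hi
      refine h (j + 1) (by omega) (by omega) ?_
      convert h2 using 1
      omega

theorem T_cons (w : List A) (a : A) (y : List A) :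
    T w (a :: y) ↔ w <:+: (a :: y) ∧ ¬ w <:+: y := by
  unfold T
  rw [List.infix_cons_iff]
  constructor
  · rintro ⟨h1, h2⟩
    exact ⟨Or.inl h1, h2 _ _ rfl⟩
  · rintro ⟨h1 | h1, h2⟩
    · refine ⟨h1, ?_⟩
      rintro a' y' h
      obtain ⟨rfl, rfl⟩ := List.cons.inj h
      exact h2
    · exact absurd h1 h2

theorem T_len (w x : List A) (h : x.length = w.length) : T w x ↔ w <:+: x := by
  constructor
  · rintro ⟨h1, -⟩
    exact h1.isInfix
  · intro h1
    have : w = x := h1.eq_of_length h.symm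
    subst this
    refine ⟨List.prefix_rfl, ?_⟩
    rintro a y rfl h2
    have := h2.length_le
    simp at this

variable [Fintype A]

/-- Factors of length `n`. -/
noncomputable def F (u : ℕ → A) (n : ℕ) : Finset (List A) :=
  Set.Finite.toFinset (s := {w : List A | w.length = n ∧ IsFactor u w})
    ((List.finite_length_eq A n).subset (fun _ h => h.1))

theorem mem_F {u : ℕ → A} {n : ℕ} {w : List A} : w ∈ F u n ↔ w.length = n ∧ IsFactor u w := by
  simp [F]

theorem mem_F' {u : ℕ → A} {n : ℕ} {w : List A} : w ∈ F u n ↔ ∃ i, w = word u i n := by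
  rw [mem_F]
  constructor
  · rintro ⟨rfl, i, hi⟩
    exact ⟨i, hi⟩
  · rintro ⟨i, rfl⟩
    exact ⟨word_length _ _ _, isFactor_word _ _ _⟩

theorem card_F (u : ℕ → A) (n : ℕ) : (F u n).card = complexity u n := by
  unfold complexity F
  rw [Set.ncard_eq_toFinset_card _ ((List.finite_length_eq A n).subset (fun _ h => h.1))]

/-- The right weight. -/
noncomputable def f (u : ℕ → A) (x : List A) : ℤ := (Set.ncard (Rext u x) : ℤ) - 1

theorem f_nonneg (u : ℕ → A) (x : List A) (h : IsFactor u x) : 0 ≤ f u x := by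
  obtain ⟨i, hi⟩ := h
  have : (Rext u x).Nonempty := by
    refine ⟨u (i + x.length), i, ?_⟩
    rw [occursAt_append]
    refine ⟨hi, ?_⟩
    rw [occursAt_cons]
    exact ⟨rfl, by simp [OccursAt, word_zero]⟩
  have := (Set.ncard_pos (Set.toFinite _)).2 this
  unfold f
  omega

theorem isFactor_left {u : ℕ → A} {x y : List A} (h : IsFactor u (x ++ y)) : IsFactor u x := by
  obtain ⟨i, hi⟩ := h
  exact ⟨i, ((occursAt_append _ _ _ _).1 hi).1⟩

theorem isFactor_right {u : ℕ → A} {x y : List A} (h : IsFactor u (x ++ y)) : IsFactor u y := by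
  obtain ⟨i, hi⟩ := h
  exact ⟨_, ((occursAt_append _ _ _ _).1 hi).2⟩

theorem isFactor_tail {u : ℕ → A} {a : A} {y : List A} (h : IsFactor u (a :: y)) :
    IsFactor u y := isFactor_right (x := [a]) h

theorem sum_Rext (u : ℕ → A) (n : ℕ) (Q : List A → Prop) :
    ∑ x ∈ (F u n).filter Q, (Set.ncard (Rext u x)) =
      ((F u (n + 1)).filter (fun v => Q v.dropLast)).card := by
  rw [Finset.card_eq_sum_card_fiberwise (f := List.dropLast) (t := (F u n).filter Q)]
  · refine Finset.sum_congr rfl fun x hx => ?_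
    rw [Finset.mem_filter, mem_F] at hx
    rw [← Set.ncard_image_of_injective (f := fun b => x ++ [b]) (Rext u x)
      (fun a b h => by simpa using h), ← Set.ncard_coe_finset]
    congr 1
    ext v
    simp only [Set.mem_image, Finset.coe_filter, Finset.mem_filter, mem_F, Set.mem_ofPred_eq, Rext]
    constructor
    · rintro ⟨b, hb, rfl⟩
      simp [hx, hb]
    · rintro ⟨⟨⟨h1, h2⟩, h3⟩, h4⟩
      have hv : v ≠ [] := by rintro rfl; simp at h1
      refine ⟨v.getLast hv, ?_, ?_⟩
      · rw [← h4, List.dropLast_append_getLast]; exact h2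
      · rw [← h4, List.dropLast_append_getLast]
  · intro v hv
    simp only [Finset.coe_filter, mem_F, Set.mem_ofPred_eq] at hv ⊢
    refine ⟨⟨by simp [hv.1.1], ?_⟩, hv.2⟩
    have hne : v ≠ [] := by rintro rfl; simp at hv
    have := hv.1.2
    rw [← List.dropLast_append_getLast hne] at this
    exact isFactor_left this

theorem sum_f_all (u : ℕ → A) (n : ℕ) :
    ∑ x ∈ F u n, f u x = (complexity u (n + 1) : ℤ) - complexity u n := by
  have h := sum_Rext u n (fun _ => True)
  simp only [Finset.filter_true] at h
  unfold f
  rw [Finset.sum_sub_distrib, ← Nat.cast_sum, h, card_F]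
  simp [card_F]

theorem sum_left (u : ℕ → A) (x : List A) (hx : IsFactor u x) :
    ∑ v ∈ (F u (x.length + 1)).filter (fun v => v.tail = x), f u v =
      (Set.ncard (Bext u x) : ℤ) - Set.ncard (Lext u x) := by
  have hL : (F u (x.length + 1)).filter (fun v => v.tail = x) =
      (Lext u x).toFinset.image (fun a => a :: x) := by
    ext v
    have hm : ∀ a, a ∈ (Lext u x).toFinset ↔ IsFactor u (a :: x) := fun a => by
      rw [Set.mem_toFinset]; rfl
    simp only [Finset.mem_filter, mem_F, Finset.mem_image, hm]
    constructor
    · rintro ⟨⟨h1, h2⟩, h3⟩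
      cases v with
      | nil => simp at h1
      | cons a y =>
        simp at h3
        subst h3
        exact ⟨a, h2, rfl⟩
    · rintro ⟨a, ha, rfl⟩
      simp [ha]
  rw [hL, Finset.sum_image (by intro a _ b _ h; simpa using h)]
  unfold f
  rw [Finset.sum_sub_distrib, ← Nat.cast_sum]
  have hB : (Bext u x).ncard = ∑ a ∈ (Lext u x).toFinset, (Rext u (a :: x)).ncard := by
    rw [Set.ncard_eq_toFinset_card', Finset.card_eq_sum_card_fiberwise (f := Prod.fst)
      (t := (Lext u x).toFinset)]
    · refine Finset.sum_congr rfl fun a ha => ?_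
      rw [← Set.ncard_image_of_injective (f := fun b => (a, b)) _
        (fun a b h => by simpa using h), ← Set.ncard_coe_finset]
      congr 1
      ext ⟨a', b⟩
      simp only [Finset.coe_filter, Set.mem_toFinset, Set.mem_ofPred_eq, Set.mem_image,
        Prod.mk.injEq]
      constructor
      · rintro ⟨h, rfl⟩; exact ⟨b, h, rfl, rfl⟩
      · rintro ⟨b', h, rfl, rfl⟩; exact ⟨h, rfl⟩
    · rintro ⟨a, b⟩ h
      rw [Finset.mem_coe, Set.mem_toFinset] at h ⊢
      exact isFactor_left (x := a :: x) (y := [b]) h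
  rw [hB, Set.ncard_eq_toFinset_card' (Lext u x)]
  simp

/-- every factor occurs at a positive position -/
def Rec (u : ℕ → A) : Prop := ∀ w, IsFactor u w → ∃ i, OccursAt u w (i + 1)

theorem local_ineq (u : ℕ → A) (hrec : Rec u)
    (hnoweak : ∀ w : List A, Bispecial u w → 0 ≤ bilateralOrder u w)
    (x : List A) (hx : IsFactor u x) :
    f u x ≤ ∑ v ∈ (F u (x.length + 1)).filter (fun v => v.tail = x), f u v := by
  by_cases hR : (Rext u x).ncard < 2
  · have h1 : f u x ≤ 0 := by unfold f; omega
    refine h1.trans (Finset.sum_nonneg fun v hv => f_nonneg _ _ ?_)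
    rw [Finset.mem_filter, mem_F] at hv
    exact hv.1.2
  by_cases hL : (Lext u x).ncard < 2
  · obtain ⟨i, hi⟩ := hrec x hx
    have ha : u i ∈ Lext u x := ⟨i, (occursAt_cons _ _ _ _).2 ⟨rfl, hi⟩⟩
    have huniq : ∀ b ∈ Lext u x, b = u i := by
      intro b hb
      exact (Set.ncard_le_one (Set.toFinite _)).1 (by omega) _ hb _ ha
    have hsub : Rext u x ⊆ Rext u (u i :: x) := by
      intro b hb
      obtain ⟨j, hj⟩ := hrec _ hb
      have hj' := ((occursAt_append _ _ _ _).1 hj).1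
      have := huniq (u j) ⟨j, (occursAt_cons _ _ _ _).2 ⟨rfl, hj'⟩⟩
      refine ⟨j, ?_⟩
      rw [List.cons_append, occursAt_cons]
      exact ⟨this.symm, hj⟩
    have h1 : f u x ≤ f u (u i :: x) := by
      have := Set.ncard_le_ncard hsub (Set.toFinite _)
      unfold f
      omega
    refine h1.trans (Finset.single_le_sum (f := f u) (fun v hv => f_nonneg _ _ ?_) ?_)
    · rw [Finset.mem_filter, mem_F] at hv
      exact hv.1.2
    · rw [Finset.mem_filter, mem_F]
      exact ⟨⟨by simp, ha⟩, rfl⟩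
  · rw [sum_left u x hx]
    have := hnoweak x ⟨hx, by omega, by omega⟩
    unfold bilateralOrder at this
    unfold f
    omega

theorem sum_ineq (u : ℕ → A) (hrec : Rec u)
    (hnoweak : ∀ w : List A, Bispecial u w → 0 ≤ bilateralOrder u w)
    (n : ℕ) (Q : List A → Prop) :
    ∑ x ∈ (F u n).filter Q, f u x ≤
      ∑ v ∈ (F u (n + 1)).filter (fun v => Q v.tail), f u v := by
  rw [← Finset.sum_fiberwise_of_maps_to (s := (F u (n + 1)).filter (fun v => Q v.tail))
    (g := List.tail) (t := (F u n).filter Q)]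
  · refine Finset.sum_le_sum fun x hx => ?_
    rw [Finset.mem_filter, mem_F] at hx
    obtain ⟨⟨rfl, hx1⟩, hx2⟩ := hx
    refine (local_ineq u hrec hnoweak x hx1).trans (le_of_eq ?_)
    rw [Finset.filter_filter]
    refine Finset.sum_congr (Finset.filter_congr fun v _ => ?_) fun _ _ => rfl
    constructor
    · rintro rfl; exact ⟨hx2, rfl⟩
    · exact fun h => h.2
  · intro v hv
    rw [Finset.mem_filter, mem_F] at hv ⊢
    refine ⟨⟨by simp [hv.1.1], ?_⟩, hv.2⟩
    cases v with
    | nil => simp at hv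
    | cons a y => exact isFactor_tail hv.1.2

theorem s_mono (u : ℕ → A) (hrec : Rec u)
    (hnoweak : ∀ w : List A, Bispecial u w → 0 ≤ bilateralOrder u w)
    (n : ℕ) : ∑ x ∈ F u 0, f u x ≤ ∑ x ∈ F u n, f u x := by
  induction n with
  | zero => rfl
  | succ n ih =>
    have := sum_ineq u hrec hnoweak n (fun _ => True)
    simp only [Finset.filter_true] at this
    exact ih.trans this

/-- Sum of weights on `T`-words of length `|w| + i`. -/
noncomputable def tS (u : ℕ → A) (w : List A) (i : ℕ) : ℤ :=
  ∑ x ∈ (F u (w.length + i)).filter (T w), f u x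

theorem lower (u : ℕ → A) (hrec : Rec u)
    (hnoweak : ∀ w : List A, Bispecial u w → 0 ≤ bilateralOrder u w)
    (w : List A) (i : ℕ) :
    ∑ x ∈ F u w.length, f u x ≤
      ∑ x ∈ (F u (w.length + i)).filter (fun x => ¬ w <:+: x), f u x
        + ∑ j ∈ Finset.range (i + 1), tS u w j := by
  induction i with
  | zero =>
    simp only [zero_add, Finset.range_one, Finset.sum_singleton, tS, add_zero]
    rw [← Finset.sum_filter_add_sum_filter_not (F u w.length) (T w), add_comm]
    refine le_of_eq (congrArg₂ _ (Finset.sum_congr (Finset.filter_congr fun x hx => ?_)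
      fun _ _ => rfl) rfl)
    rw [T_len w x (mem_F.1 hx).1]
  | succ i ih =>
    refine ih.trans ?_
    rw [Finset.sum_range_succ _ (i + 1)]
    have h1 : ∑ x ∈ (F u (w.length + i)).filter (fun x => ¬ w <:+: x), f u x ≤
        ∑ x ∈ (F u (w.length + i + 1)).filter (fun x => ¬ w <:+: x), f u x +
        ∑ x ∈ (F u (w.length + i + 1)).filter (T w), f u x := by
      refine (le_of_eq (Finset.sum_congr (by ext; simp) fun _ _ => rfl)).trans
        ((sum_ineq u hrec hnoweak (w.length + i) (fun x => ¬ w <:+: x)).trans (le_of_eq ?_))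
      rw [← Finset.sum_union]
      · refine Finset.sum_congr ?_ fun _ _ => rfl
        ext x
        simp only [Finset.mem_filter, Finset.mem_union, ← and_or_left]
        refine and_congr_right fun hx => ?_
        have := (mem_F.1 hx).1
        cases x with
        | nil => simp at this
        | cons a y =>
          rw [T_cons, List.tail_cons]
          have : w <:+: y → w <:+: a :: y := fun h => List.infix_cons_iff.2 (Or.inr h)
          tauto
      · refine Finset.disjoint_left.2 fun x h1 h2 => ?_
        exact (Finset.mem_filter.1 h1).2 (Finset.mem_filter.1 h2).2.1.isInfix
    have h4 : tS u w (i + 1) = ∑ x ∈ (F u (w.length + i + 1)).filter (T w), f u x := rfl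
    rw [h4, ← add_assoc w.length i 1]
    linarith

theorem upper (u : ℕ → A) (hrec : Rec u)
    (hnoweak : ∀ w : List A, Bispecial u w → 0 ≤ bilateralOrder u w)
    (w : List A) (i : ℕ) :
    ∑ j ∈ Finset.range (i + 1), tS u w j ≤
      ∑ x ∈ (F u (w.length + i)).filter (fun x => w <:+: x), f u x := by
  induction i with
  | zero =>
    simp only [zero_add, Finset.range_one, Finset.sum_singleton, tS, add_zero]
    refine le_of_eq (Finset.sum_congr (Finset.filter_congr fun x hx => ?_) fun _ _ => rfl)
    rw [T_len w x (mem_F.1 hx).1]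
  | succ i ih =>
    rw [Finset.sum_range_succ _ (i + 1)]
    have h1 : ∑ x ∈ (F u (w.length + i)).filter (fun x => w <:+: x), f u x +
        ∑ x ∈ (F u (w.length + i + 1)).filter (T w), f u x ≤
        ∑ x ∈ (F u (w.length + i + 1)).filter (fun x => w <:+: x), f u x := by
      have h0 := sum_ineq u hrec hnoweak (w.length + i) (fun x => w <:+: x)
      refine (add_le_add_left ((le_of_eq (Finset.sum_congr (by ext; simp) fun _ _ => rfl)).trans
        h0) _).trans (le_of_eq ?_)
      rw [← Finset.sum_union]
      · refine Finset.sum_congr ?_ fun _ _ => rfl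
        ext x
        simp only [Finset.mem_filter, Finset.mem_union, ← and_or_left]
        refine and_congr_right fun hx => ?_
        have := (mem_F.1 hx).1
        cases x with
        | nil => simp at this
        | cons a y =>
          rw [T_cons, List.tail_cons]
          have : w <:+: y → w <:+: a :: y := fun h => List.infix_cons_iff.2 (Or.inr h)
          tauto
      · refine Finset.disjoint_left.2 fun x h1 h2 => ?_
        simp only [Finset.mem_filter, mem_F] at h1 h2
        cases x with
        | nil => simp at h1
        | cons a y => exact ((T_cons _ _ _).1 h2.2).2 h1.2
    have h4 : tS u w (i + 1) = ∑ x ∈ (F u (w.length + i + 1)).filter (T w), f u x := rfl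
    rw [h4, ← add_assoc w.length i 1]
    linarith

/-- Complete return words of length `|w| + i + 1`. -/
noncomputable def R (u : ℕ → A) (w : List A) (i : ℕ) : Finset (List A) :=
  (F u (w.length + i + 1)).filter (fun v => T w v.dropLast ∧ ¬ T w v)

theorem word_dropLast (u : ℕ → A) (i n : ℕ) : (word u i (n + 1)).dropLast = word u i n := by
  rw [word_succ_snoc]; simp

theorem tS_eq (u : ℕ → A) (w : List A) (i : ℕ) :
    tS u w i = ((F u (w.length + i + 1)).filter (T w)).card + (R u w i).card
      - ((F u (w.length + i)).filter (T w)).card := by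
  unfold tS f
  rw [Finset.sum_sub_distrib, ← Nat.cast_sum, sum_Rext]
  simp only [Finset.sum_const, nsmul_eq_mul, mul_one]
  congr 1
  rw [← Finset.card_filter_add_card_filter_not (s := Finset.filter _ _) (T w),
    Finset.filter_filter, Finset.filter_filter]
  push_cast
  congr 3
  refine Finset.filter_congr fun x hx => ?_
  obtain ⟨j, rfl⟩ := mem_F'.1 hx
  rw [word_dropLast, T_word, T_word]
  constructor
  · exact fun h => h.2
  · intro h
    exact ⟨⟨by omega, h.2.1, fun k h1 h2 => h.2.2 k h1 (by omega)⟩, h⟩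

theorem tS_sum (u : ℕ → A) (w : List A) (hw : IsFactor u w) (n : ℕ) :
    ∑ j ∈ Finset.range n, tS u w j = ((F u (w.length + n)).filter (T w)).card
      + ∑ j ∈ Finset.range n, ((R u w j).card : ℤ) - 1 := by
  induction n with
  | zero =>
    have : (F u (w.length + 0)).filter (T w) = {w} := by
      ext x
      simp only [Finset.mem_filter, mem_F, add_zero, Finset.mem_singleton]
      constructor
      · rintro ⟨⟨h1, h2⟩, h3⟩
        exact (((T_len w x h1).1 h3).eq_of_length h1.symm).symm
      · rintro rfl
        exact ⟨⟨rfl, hw⟩, (T_len x x rfl).2 List.infix_rfl⟩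
    rw [this]
    simp
  | succ n ih =>
    rw [Finset.sum_range_succ, Finset.sum_range_succ, ih, tS_eq, ← add_assoc w.length n 1]
    ring

theorem mem_R (u : ℕ → A) (w : List A) (n : ℕ) (v : List A) :
    v ∈ R u w n ↔ ∃ i, SuccOccurrences u w i (i + n + 1) ∧ v = word u i (n + 1) ++ w := by
  unfold R
  rw [Finset.mem_filter, mem_F']
  constructor
  · rintro ⟨⟨i, rfl⟩, h1, h2⟩
    rw [word_dropLast, T_word] at h1
    rw [T_word] at h2
    push Not at h2
    obtain ⟨j, hj0, hj, hoc⟩ := h2 (by omega) h1.2.1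
    have hjn : j = n + 1 := by
      by_contra hne
      exact h1.2.2 j hj0 (by omega) hoc
    subst hjn
    refine ⟨i, ⟨h1.2.1, hoc, by omega, ?_⟩, ?_⟩
    · intro l hl1 hl2
      have := h1.2.2 (l - i) (by omega) (by omega)
      rwa [show i + (l - i) = l by omega] at this
    · rw [show w.length + n + 1 = (n + 1) + w.length by omega, word_add, ← hoc]
  · rintro ⟨i, ⟨h1, h2, h3, h4⟩, rfl⟩
    have e : word u i (n + 1) ++ w = word u i (w.length + n + 1) := by
      rw [show w.length + n + 1 = (n + 1) + w.length by omega, word_add u i (n + 1)]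
      exact congrArg _ h2
    rw [e]
    refine ⟨⟨i, rfl⟩, ?_, ?_⟩
    · rw [word_dropLast, T_word]
      exact ⟨by omega, h1, fun j hj0 hj => h4 _ (by omega) (by omega)⟩
    · rw [T_word]
      intro h
      exact h.2.2 (n + 1) (by omega) (by omega) h2

theorem card_ret (u : ℕ → A) (w : List A) (N : ℕ)
    (hN : ∀ j k, SuccOccurrences u w j k → k ≤ j + N) :
    (returnWords u w).ncard = ∑ j ∈ Finset.range N, (R u w j).card := by
  rw [← Finset.card_biUnion, ← Set.ncard_coe_finset,
    ← Set.ncard_image_of_injective (f := fun r => r ++ w) _ (List.append_left_injective w)]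
  · congr 1
    ext v
    simp only [Set.mem_image, returnWords, Set.mem_ofPred_eq, Finset.coe_biUnion, Set.mem_iUnion,
      Finset.mem_coe, mem_R, Finset.mem_range, exists_prop]
    constructor
    · rintro ⟨r, ⟨j, k, h, rfl⟩, rfl⟩
      have h1 := hN _ _ h
      have h2 := h.2.2.1
      refine ⟨k - j - 1, by omega, j, ?_, ?_⟩
      · rwa [show j + (k - j - 1) + 1 = k by omega]
      · rw [show (k - j - 1) + 1 = k - j by omega]
    · rintro ⟨n, hn, i, h, rfl⟩
      refine ⟨_, ⟨i, i + n + 1, h, rfl⟩, ?_⟩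
      rw [show i + n + 1 - i = n + 1 by omega]
  · intro i _ j _ hij
    refine Finset.disjoint_left.2 fun v h1 h2 => hij ?_
    have h1 := (mem_F.1 (Finset.mem_filter.1 h1).1).1
    have h2 := (mem_F.1 (Finset.mem_filter.1 h2).1).1
    omega

theorem sandwich (u : ℕ → A) (hur : UniformlyRecurrent u)
    (hnoweak : ∀ w : List A, Bispecial u w → 0 ≤ bilateralOrder u w)
    (w : List A) (hw : IsFactor u w) :
    ∑ x ∈ F u w.length, f u x ≤ ((returnWords u w).ncard : ℤ) - 1 ∧
      ∃ n, ((returnWords u w).ncard : ℤ) - 1 ≤ ∑ x ∈ F u n, f u x := by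
  have hrec : Rec u := by
    intro v hv
    obtain ⟨N, hN⟩ := hur v hv
    obtain ⟨j, h1, -, h2⟩ := hN 1
    exact ⟨j - 1, by rwa [show j - 1 + 1 = j by omega]⟩
  obtain ⟨N, hN⟩ := hur w hw
  have hret : (returnWords u w).ncard = ∑ j ∈ Finset.range (N + 1), (R u w j).card := by
    apply card_ret
    rintro j k ⟨h1, h2, h3, h4⟩
    obtain ⟨l, hl1, hl2, hl3⟩ := hN (j + 1)
    by_contra hc
    exact h4 l (by omega) (by omega) hl3
  have hT : (F u (w.length + (N + 1))).filter (T w) = ∅ := by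
    rw [Finset.filter_eq_empty_iff]
    intro x hx h
    obtain ⟨i, rfl⟩ := mem_F'.1 hx
    rw [T_word] at h
    obtain ⟨l, hl1, hl2, hl3⟩ := hN (i + 1)
    refine h.2.2 (l - i) (by omega) (by omega) ?_
    rwa [show i + (l - i) = l by omega]
  have hE : (F u (w.length + N)).filter (fun x => ¬ w <:+: x) = ∅ := by
    rw [Finset.filter_eq_empty_iff]
    intro x hx h
    obtain ⟨i, rfl⟩ := mem_F'.1 hx
    obtain ⟨l, hl1, hl2, hl3⟩ := hN i
    refine h ((infix_word _ _ _ _).2 ⟨l - i, by omega, ?_⟩)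
    rwa [show i + (l - i) = l by omega]
  have hsum := tS_sum u w hw (N + 1)
  rw [hT, ← Nat.cast_sum, ← hret] at hsum
  simp only [Finset.card_empty, Nat.cast_zero, zero_add] at hsum
  have hlo := lower u hrec hnoweak w N
  have hup := upper u hrec hnoweak w N
  rw [hE, Finset.sum_empty, zero_add, hsum] at hlo
  rw [hsum] at hup
  refine ⟨hlo, w.length + N, hup.trans ?_⟩
  refine Finset.sum_le_sum_of_subset_of_nonneg (Finset.filter_subset _ _) fun x hx _ => ?_
  exact f_nonneg _ _ (mem_F.1 hx).2

theorem comp_zero (u : ℕ → A) : complexity u 0 = 1 := by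
  rw [← card_F, Finset.card_eq_one]
  refine ⟨[], ?_⟩
  ext x
  rw [mem_F', Finset.mem_singleton]
  simp [word_zero]

theorem comp_one (u : ℕ → A) (hall : AllLettersOccur u) : complexity u 1 = Fintype.card A := by
  rw [← card_F, ← Finset.card_univ,
    ← Finset.card_image_of_injective Finset.univ (f := fun a : A => [a])
      (fun a b h => by simpa using h)]
  congr 1
  ext x
  rw [mem_F']
  simp only [word_one, Finset.mem_image, Finset.mem_univ, true_and]
  constructor
  · rintro ⟨i, rfl⟩
    exact ⟨_, rfl⟩
  · rintro ⟨a, rfl⟩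
    obtain ⟨i, rfl⟩ := hall a
    exact ⟨i, rfl⟩

theorem ur_of_ret (u : ℕ → A)
    (h : ∀ w : List A, IsFactor u w → Set.ncard (returnWords u w) = Fintype.card A) :
    UniformlyRecurrent u := by
  have hk : 0 < Fintype.card A := Fintype.card_pos_iff.2 ⟨u 0⟩
  intro w hw
  have hinf : ∀ N, ∃ i, N ≤ i ∧ OccursAt u w i := by
    intro N
    induction N with
    | zero => exact hw.imp fun i hi => ⟨Nat.zero_le _, hi⟩
    | succ N ih =>
      obtain ⟨i, hi, ho⟩ := ih
      have hne : (returnWords u (word u 0 (i + w.length))).Nonempty := by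
        apply Set.nonempty_of_ncard_ne_zero
        rw [h _ (isFactor_word _ _ _)]
        omega
      obtain ⟨v, j, k, ⟨h1, h2, h3, h4⟩, -⟩ := hne
      rw [word_add, occursAt_append, word_length, zero_add, ← ho] at h2
      exact ⟨k + i, by omega, h2.2⟩
  have hfin : (returnWords u w).Finite := Set.finite_of_ncard_pos (by rw [h w hw]; exact hk)
  obtain ⟨B, hB⟩ := (hfin.image List.length).bddAbove
  have hgap : ∀ j k, SuccOccurrences u w j k → k ≤ j + B := by
    intro j k hjk
    have := hB ⟨_, ⟨j, k, hjk, rfl⟩, rfl⟩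
    rw [word_length] at this
    omega
  obtain ⟨i0, hi0⟩ := hw
  refine ⟨i0 + B + 1, fun i => ?_⟩
  have hex := hinf i
  have hs := Nat.find_spec hex
  have hm := fun l => Nat.find_min (H := hex) (m := l)
  refine ⟨Nat.find hex, hs.1, ?_, hs.2⟩
  by_cases hlt : i ≤ i0
  · have := Nat.find_min' hex ⟨hlt, hi0⟩
    omega
  · have h1 := Nat.findGreatest_spec (P := fun l => OccursAt u w l) (n := i - 1) (m := i0)
      (by omega) hi0
    have h2 := Nat.findGreatest_le (P := fun l => OccursAt u w l) (i - 1)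
    have h3 := fun l => Nat.findGreatest_is_greatest (P := fun l => OccursAt u w l)
      (n := i - 1) (k := l)
    have := hgap (Nat.findGreatest (fun l => OccursAt u w l) (i - 1)) (Nat.find hex)
      ⟨h1, hs.2, by omega, fun l hl1 hl2 hl3 => by
        by_cases hli : l < i
        · exact h3 l hl1 (by omega) hl3
        · exact hm l hl2 ⟨by omega, hl3⟩⟩
    omega

end RW

/-- If `u` (over a `k`-letter alphabet) has no weak bispecial
factors, then every factor of `u` has exactly `k` return words iff `u` is
uniformly recurrent and `C(n) = (k−1)n + 1` for all `n`. -/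
theorem stmt13 {A : Type*} [Fintype A] (u : ℕ → A)
    (hall : AllLettersOccur u)
    (hnoweak : ∀ w : List A, Bispecial u w → 0 ≤ bilateralOrder u w) :
    (∀ w : List A, IsFactor u w →
        Set.ncard (returnWords u w) = Fintype.card A) ↔
      (UniformlyRecurrent u ∧
        ∀ n : ℕ, complexity u n = (Fintype.card A - 1) * n + 1) := by
  have hk : 0 < Fintype.card A := Fintype.card_pos_iff.2 ⟨u 0⟩
  obtain ⟨k, hk'⟩ : ∃ k, Fintype.card A = k + 1 := ⟨Fintype.card A - 1, by omega⟩
  rw [hk', Nat.add_sub_cancel]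
  constructor
  · intro h
    have hur := RW.ur_of_ret u (by rwa [hk'])
    refine ⟨hur, fun n => ?_⟩
    have hrec : RW.Rec u := by
      intro v hv
      obtain ⟨N, hN⟩ := hur v hv
      obtain ⟨j, h1, -, h2⟩ := hN 1
      exact ⟨j - 1, by rwa [show j - 1 + 1 = j by omega]⟩
    induction n with
    | zero => simp [RW.comp_zero]
    | succ n ih =>
      have h1 := RW.s_mono u hrec hnoweak n
      have h2 := (RW.sandwich u hur hnoweak (word u 0 n) (RW.isFactor_word _ _ _)).1
      rw [h _ (RW.isFactor_word _ _ _), RW.word_length] at h2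
      rw [RW.sum_f_all, RW.sum_f_all, RW.comp_zero, zero_add, RW.comp_one u hall, hk'] at h1
      rw [RW.sum_f_all] at h2
      rw [mul_add, mul_one]
      push_cast at h1 h2
      omega
  · rintro ⟨hur, hC⟩ w hw
    have hs : ∀ n, ∑ x ∈ RW.F u n, RW.f u x = (k : ℤ) := by
      intro n
      rw [RW.sum_f_all, hC, hC]
      push_cast
      ring
    obtain ⟨h1, n, h2⟩ := RW.sandwich u hur hnoweak w hw
    rw [hs] at h1 h2
    omega
end

section
/- Let u be a uniformly recurrent infinite word over a three-letter alphabet. Then every bispecial factor of u is ordinary (Property BO) if and only if every factor of u has exactly three return words (Property R). -/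
open List

section helpers

open Classical in
/-- right extensions as a finset -/
noncomputable def reF {A : Type*} [Fintype A] (u : ℕ → A) (v : List A) : Finset A :=
  Finset.univ.filter (fun b => IsFactor u (v ++ [b]))

open Classical in
/-- left extensions as a finset -/
noncomputable def leF {A : Type*} [Fintype A] (u : ℕ → A) (v : List A) : Finset A :=
  Finset.univ.filter (fun a => IsFactor u (a :: v))

noncomputable def phi {A : Type*} [Fintype A] (u : ℕ → A) (v : List A) : ℤ :=
  ((reF u v).card : ℤ) - 1

noncomputable def bil {A : Type*} [Fintype A] (u : ℕ → A) (v : List A) : ℤ :=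
  ∑ a ∈ leF u v, phi u (a :: v) - phi u v

def Xs {A : Type*} (u : ℕ → A) (w : List A) : Set (List A) :=
  {v | IsFactor u v ∧ w <+: v ∧ ∀ s, s <:+ v → w <+: s → s = v}

def Ts {A : Type*} (u : ℕ → A) (w : List A) : Set (List A) :=
  {v | IsFactor u v ∧ ¬ w <:+: v}

def Cs {A : Type*} (u : ℕ → A) (w : List A) : Set (List A) :=
  {c | IsFactor u c ∧ c ≠ w ∧ w <+: c ∧ w <:+ c ∧ ∀ s t, c = s ++ w ++ t → s = [] ∨ t = []}

variable {A : Type*} {u : ℕ → A}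

theorem word_length (i n : ℕ) : (word u i n).length = n := by simp [word]

theorem word_add (i m n : ℕ) : word u i (m + n) = word u i m ++ word u (i + m) n := by
  simp [word, List.range_add, Function.comp_def, Nat.add_assoc]

theorem occ_word (i n : ℕ) : OccursAt u (word u i n) i := by
  simp [OccursAt, word_length]

theorem occ_append {s t : List A} {i : ℕ} :
    OccursAt u (s ++ t) i ↔ OccursAt u s i ∧ OccursAt u t (i + s.length) := by
  unfold OccursAt
  rw [List.length_append, word_add]
  constructor
  · intro h
    exact List.append_inj h (by simp [word_length])
  · rintro ⟨h1, h2⟩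
    rw [← h1, ← h2]

theorem fac_sub {s t : List A} (h : s <:+: t) (ht : IsFactor u t) : IsFactor u s := by
  obtain ⟨p, q, rfl⟩ := h
  obtain ⟨i, hi⟩ := ht
  rw [occ_append, occ_append] at hi
  exact ⟨_, hi.1.2⟩

theorem exists_right {v : List A} (hv : IsFactor u v) : ∃ b, IsFactor u (v ++ [b]) := by
  obtain ⟨i, hi⟩ := hv
  refine ⟨u (i + v.length), i, ?_⟩
  rw [occ_append]
  exact ⟨hi, by simp [OccursAt, word]⟩

theorem exists_left (hur : UniformlyRecurrent u) {v : List A} (hv : IsFactor u v) :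
    ∃ a, IsFactor u (a :: v) := by
  obtain ⟨N, hN⟩ := hur v hv
  obtain ⟨j, hj, -, h⟩ := hN 1
  refine ⟨u (j - 1), j - 1, ?_⟩
  have : (u (j-1) :: v) = [u (j-1)] ++ v := rfl
  rw [this, occ_append]
  refine ⟨by simp [OccursAt, word], ?_⟩
  simpa [Nat.sub_add_cancel hj] using h

theorem long_contains (hur : UniformlyRecurrent u) {w : List A} (hw : IsFactor u w) :
    ∃ M, ∀ v, IsFactor u v → M ≤ v.length → w <:+: v := by
  obtain ⟨N, hN⟩ := hur w hw
  refine ⟨N + w.length, ?_⟩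
  rintro v ⟨i, hi⟩ hl
  obtain ⟨j, hj, hj2, h⟩ := hN i
  have e : v.length = (j - i) + (w.length + (v.length - (j - i) - w.length)) := by omega
  unfold OccursAt at hi h
  rw [e, word_add, word_add, show i + (j - i) = j by omega, ← h] at hi
  exact ⟨_, _, by rw [List.append_assoc]; exact hi.symm⟩

theorem Ts_finite [Finite A] (hur : UniformlyRecurrent u) {w : List A} (hw : IsFactor u w) :
    (Ts u w).Finite := by
  obtain ⟨M, hM⟩ := long_contains hur hw
  refine (List.finite_length_lt A M).subset ?_
  rintro v ⟨h1, h2⟩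
  by_contra h
  exact h2 (hM v h1 (by simpa using h))

theorem Xs_step {w v : List A} {a : A} (hw : w ≠ []) (h : a :: v ∈ Xs u w) : v ∈ Ts u w := by
  obtain ⟨h1, h2, h3⟩ := h
  refine ⟨fac_sub (List.suffix_cons a v).isInfix h1, ?_⟩
  rintro ⟨p, q, rfl⟩
  have := h3 (w ++ q) ⟨a :: p, by simp⟩ (List.prefix_append _ _)
  have := congrArg List.length this
  simp at this
  omega

theorem Xs_finite [Finite A] (hur : UniformlyRecurrent u) {w : List A} (hw : IsFactor u w) :
    (Xs u w).Finite := by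
  by_cases h0 : w = []
  · refine (Set.finite_singleton ([] : List A)).subset ?_
    rintro v ⟨-, -, h⟩
    subst h0
    exact (h [] List.nil_suffix (List.prefix_rfl)).symm
  · have h1 := Set.Finite.image2 (fun (a : A) v => a :: v) (Set.finite_univ (α := A)) (Ts_finite hur hw)
    refine h1.subset ?_
    intro v hv
    cases v with
    | nil => exact absurd (List.prefix_nil.mp hv.2.1) h0
    | cons a v => exact ⟨a, trivial, v, Xs_step h0 hv, rfl⟩

theorem mem_Xs_self {w : List A} (hw : IsFactor u w) : w ∈ Xs u w :=
  ⟨hw, List.prefix_rfl, fun _ hs hp => hs.eq_of_length (le_antisymm hs.length_le hp.length_le)⟩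

theorem last_occ {w : List A} : ∀ {y : List A}, IsFactor u y → w <:+: y →
    ∃ s, s <:+ y ∧ s ∈ Xs u w := by
  intro y
  induction y with
  | nil =>
    intro hy h
    have : w = [] := List.infix_nil.mp h
    subst this
    exact ⟨[], List.suffix_rfl, mem_Xs_self hy⟩
  | cons a y ih =>
    intro hy h
    by_cases h2 : w <:+: y
    · obtain ⟨s, hs, hx⟩ := ih (fac_sub (List.suffix_cons a y).isInfix hy) h2
      exact ⟨s, hs.trans (List.suffix_cons a y), hx⟩
    · refine ⟨a :: y, List.suffix_rfl, hy, ?_, ?_⟩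
      · rcases List.infix_cons_iff.mp h with h | h
        · exact h
        · exact absurd h h2
      · intro s hs hp
        rcases List.suffix_cons_iff.mp hs with h | h
        · exact h
        · exact absurd (hp.isInfix.trans h.isInfix) h2

theorem Cs_ncard (w : List A) : (Cs u w).ncard = (returnWords u w).ncard := by
  have : Cs u w = (fun r => r ++ w) '' returnWords u w := by
    ext c
    constructor
    · rintro ⟨⟨i, hi⟩, h1, h2, ⟨r, rfl⟩, h4⟩
      obtain ⟨q, hq⟩ := h2
      refine ⟨r, ⟨i, i + r.length, ⟨?_, ?_, ?_, ?_⟩, ?_⟩, rfl⟩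
      · rw [← hq] at hi
        exact (occ_append.mp hi).1
      · exact (occ_append.mp hi).2
      · have : r ≠ [] := by rintro rfl; simp at h1
        have := List.length_pos_iff.mpr this
        omega
      · intro l hl1 hl2 hl
        have hr : r ++ w = word u i (r ++ w).length := hi
        have e : (r ++ w).length = (l - i) + (w.length + (r.length - (l - i))) := by simp; omega
        unfold OccursAt at hl
        rw [e, word_add, word_add, show i + (l - i) = l by omega, ← hl, ← List.append_assoc] at hr
        rcases h4 _ _ hr with h | h
        · have := congrArg List.length h
          rw [word_length] at this; simp at this; omega
        · have := congrArg List.length h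
          rw [word_length] at this; simp at this; omega
      · simpa [OccursAt] using (occ_append.mp hi).1
    · rintro ⟨r, ⟨j, k, ⟨hj, hk, hjk, hno⟩, rfl⟩, rfl⟩
      have hocc : OccursAt u (word u j (k - j) ++ w) j := by
        rw [occ_append, word_length, show j + (k - j) = k by omega]
        exact ⟨occ_word _ _, hk⟩
      refine ⟨⟨j, hocc⟩, ?_, ?_, List.suffix_append _ _, ?_⟩
      · intro h
        have := congrArg List.length h
        simp [word_length] at this; omega
      · have h1 := hocc
        unfold OccursAt at h1 hj
        rw [List.length_append, Nat.add_comm, word_add, ← hj] at h1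
        exact ⟨_, h1.symm⟩
      · intro s t hst
        replace hst : word u j (k - j) ++ w = s ++ w ++ t := hst
        rw [hst, occ_append, occ_append] at hocc
        by_contra! hcon
        have h1 := List.length_pos_iff.mpr hcon.1
        have h2 := List.length_pos_iff.mpr hcon.2
        have h3 := congrArg List.length hst
        simp [word_length] at h3
        exact hno (j + s.length) (by omega) (by omega) hocc.1.2
  rw [this, Set.ncard_image_of_injective _ (List.append_left_injective w)]

variable [Fintype A]

theorem mem_reF {v : List A} {b : A} : b ∈ reF u v ↔ IsFactor u (v ++ [b]) := by simp [reF]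
theorem mem_leF {v : List A} {a : A} : a ∈ leF u v ↔ IsFactor u (a :: v) := by simp [leF]

theorem phi_nonneg {v : List A} (hv : IsFactor u v) : 0 ≤ phi u v := by
  obtain ⟨b, hb⟩ := exists_right hv
  have : 0 < (reF u v).card := Finset.card_pos.mpr ⟨b, mem_reF.mpr hb⟩
  unfold phi; omega

theorem phi_suffix {s v : List A} (h : s <:+ v) : phi u v ≤ phi u s := by
  have : reF u v ⊆ reF u s := by
    intro b hb
    rw [mem_reF] at *
    obtain ⟨p, rfl⟩ := h
    exact fac_sub ⟨p, [], by simp⟩ hb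
  have := Finset.card_le_card this
  unfold phi; omega

theorem lemmaA (hur : UniformlyRecurrent u) {w : List A} (hw : IsFactor u w) :
    ((returnWords u w).ncard : ℤ) = 1 + ∑ v ∈ (Xs_finite hur hw).toFinset, phi u v := by
  classical
  set X := (Xs_finite hur hw).toFinset with hX
  have memX : ∀ v, v ∈ X ↔ v ∈ Xs u w := by simp [hX]
  set E : Finset (List A) := (X.sigma (fun v => reF u v)).image (fun p => p.1 ++ [p.2]) with hE
  have cardE : E.card = ∑ v ∈ X, (reF u v).card := by
    rw [hE, Finset.card_image_of_injOn, Finset.card_sigma]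
    rintro ⟨v, b⟩ - ⟨v', b'⟩ - h
    have := List.append_inj' h rfl
    simp at this
    simp [this]
  have memE : ∀ c, c ∈ E ↔ ∃ v b, v ∈ Xs u w ∧ IsFactor u (v ++ [b]) ∧ v ++ [b] = c := by
    intro c
    simp [hE, memX, mem_reF, and_assoc]
  have hsub : (E : Set (List A)) = ((X.erase w : Finset (List A)) : Set (List A)) ∪ Cs u w := by
    ext c
    simp only [Finset.mem_coe, memE, Set.mem_union, Finset.mem_erase, memX]
    constructor
    · rintro ⟨v, b, ⟨h1, h2, h3⟩, hf, rfl⟩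
      have hne : v ++ [b] ≠ w := by
        intro h
        have := congrArg List.length h
        have := h2.length_le
        simp at *; omega
      have hp : w <+: v ++ [b] := h2.trans (List.prefix_append _ _)
      by_cases hx : v ++ [b] ∈ Xs u w
      · exact Or.inl ⟨hne, hx⟩
      right
      have : ∃ s, s <:+ v ++ [b] ∧ w <+: s ∧ s ≠ v ++ [b] := by
        by_contra! hcon
        exact hx ⟨hf, hp, hcon⟩
      obtain ⟨s, hs1, hs2, hs3⟩ := this
      refine ⟨hf, hne, hp, ?_, ?_⟩
      · rcases List.suffix_concat_iff.mp hs1 with h | ⟨s', rfl, h⟩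
        · subst h
          rw [List.prefix_nil.mp hs2]; exact List.nil_suffix
        · rcases List.prefix_concat_iff.mp hs2 with h4 | h4
          · rw [h4]; exact hs1
          · exact absurd (by rw [h3 s' h h4]) hs3
      · intro s1 t ht
        rcases List.eq_nil_or_concat t with h | ⟨t', b', rfl⟩
        · exact Or.inr h
        left
        rw [List.concat_eq_append, ← List.append_assoc] at ht
        have h5 := (List.append_inj' ht rfl).1
        have h6 := h3 (w ++ t') ⟨s1, by rw [h5, List.append_assoc]⟩ (List.prefix_append _ _)
        have := congrArg List.length (h6.trans h5)
        simp at this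
        exact List.length_eq_zero_iff.mp (by simpa using this)
    · have key : ∀ c, IsFactor u c → w <+: c → c ≠ w → ∃ t b, c = (w ++ t) ++ [b] := by
        rintro c - ⟨t, rfl⟩ hne
        rcases List.eq_nil_or_concat t with h | ⟨t', b', rfl⟩
        · subst h; simp at hne
        · exact ⟨t', b', by simp⟩
      rintro (⟨hne, h1, h2, h3⟩ | ⟨h1, hne, h2, h3, h4⟩)
      · obtain ⟨t, b, rfl⟩ := key c h1 h2 hne
        refine ⟨w ++ t, b, ⟨fac_sub (List.prefix_append _ _).isInfix h1, List.prefix_append _ _, ?_⟩, h1, rfl⟩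
        rintro s ⟨p, hp⟩ hws
        have := h3 (s ++ [b]) ⟨p, by rw [← hp]; simp⟩ (hws.trans (List.prefix_append _ _))
        exact (List.append_inj' this rfl).1
      · obtain ⟨t, b, rfl⟩ := key c h1 h2 hne
        refine ⟨w ++ t, b, ⟨fac_sub (List.prefix_append _ _).isInfix h1, List.prefix_append _ _, ?_⟩, h1, rfl⟩
        rintro s ⟨p, hp⟩ ⟨q, rfl⟩
        rcases h4 p (q ++ [b]) (by rw [← hp]; simp) with h | h
        · subst h; simpa using hp
        · simp at h
  have hdis : Disjoint ((X.erase w : Finset (List A)) : Set (List A)) (Cs u w) := by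
    rw [Set.disjoint_left]
    intro c hc hc'
    simp only [Finset.mem_coe, Finset.mem_erase, memX] at hc
    exact hc.1 (hc.2.2.2 w hc'.2.2.2.1 List.prefix_rfl).symm
  have hCfin : (Cs u w).Finite := (Finset.finite_toSet E).subset (by rw [hsub]; exact Set.subset_union_right)
  have hcard : E.card = (X.erase w).card + (returnWords u w).ncard := by
    rw [← Set.ncard_coe_finset E, hsub, Set.ncard_union_eq hdis (Finset.finite_toSet _) hCfin,
      Set.ncard_coe_finset, Cs_ncard]
  have hwX : w ∈ X := (memX w).mpr (mem_Xs_self hw)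
  have h1 := Finset.card_erase_add_one hwX
  have : ∑ v ∈ X, phi u v = ((∑ v ∈ X, (reF u v).card : ℕ) : ℤ) - X.card := by
    simp [phi]
  rw [this, ← cardE]
  omega

theorem lemmaB (hur : UniformlyRecurrent u) {w : List A} (hw : IsFactor u w) (h0 : w ≠ []) :
    ∑ v ∈ (Xs_finite hur hw).toFinset, phi u v
      = phi u [] + ∑ v ∈ (Ts_finite hur hw).toFinset, bil u v := by
  classical
  set X := (Xs_finite hur hw).toFinset with hX
  have memX : ∀ v, v ∈ X ↔ v ∈ Xs u w := by simp [hX]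
  set T := (Ts_finite hur hw).toFinset with hT
  have memT : ∀ v, v ∈ T ↔ v ∈ Ts u w := by simp [hT]
  set E : Finset (List A) := (T.sigma (fun v => leF u v)).image (fun p => p.2 :: p.1) with hE
  have sumE : ∑ x ∈ E, phi u x = ∑ v ∈ T, ∑ a ∈ leF u v, phi u (a :: v) := by
    rw [hE, Finset.sum_image, Finset.sum_sigma]
    rintro ⟨v, b⟩ - ⟨v', b'⟩ - h
    simp at h
    simp [h]
  have memE : ∀ c, c ∈ E ↔ ∃ v a, v ∈ Ts u w ∧ IsFactor u (a :: v) ∧ a :: v = c := by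
    intro c
    simp [hE, memT, mem_leF, and_assoc]
  have hEq : E = T.erase [] ∪ X := by
    ext c
    simp only [memE, Finset.mem_union, Finset.mem_erase, memX, memT]
    constructor
    · rintro ⟨v, a, ⟨h1, h2⟩, hf, rfl⟩
      by_cases hx : w <:+: a :: v
      · right
        refine ⟨hf, ?_, ?_⟩
        · rcases List.infix_cons_iff.mp hx with h | h
          · exact h
          · exact absurd h h2
        · intro s hs hp
          rcases List.suffix_cons_iff.mp hs with h | h
          · exact h
          · exact absurd (hp.isInfix.trans h.isInfix) h2
      · exact Or.inl ⟨by simp, hf, hx⟩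
    · rintro (⟨hne, h1, h2⟩ | hx)
      · cases c with
        | nil => simp at hne
        | cons a v =>
          exact ⟨v, a, ⟨fac_sub (List.suffix_cons a v).isInfix h1,
            fun h => h2 (h.trans (List.suffix_cons a v).isInfix)⟩, h1, rfl⟩
      · cases c with
        | nil => exact absurd (List.prefix_nil.mp hx.2.1) h0
        | cons a v => exact ⟨v, a, Xs_step h0 hx, hx.1, rfl⟩
  have hdis : Disjoint (T.erase []) X := by
    rw [Finset.disjoint_left]
    intro c hc hc'
    rw [Finset.mem_erase, memT] at hc
    rw [memX] at hc'
    exact hc.2.2 hc'.2.1.isInfix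
  have hnil : [] ∈ T := (memT _).mpr ⟨⟨0, rfl⟩, fun h => h0 (List.infix_nil.mp h)⟩
  have h1 := Finset.sum_erase_add T (phi u) hnil
  rw [hEq, Finset.sum_union hdis] at sumE
  simp only [bil, Finset.sum_sub_distrib]
  rw [← sumE]
  linarith

theorem Lext_ncard (v : List A) : (Lext u v).ncard = (leF u v).card := by
  rw [← Set.ncard_coe_finset]; congr 1; ext a; simp [Lext, mem_leF]

theorem Rext_ncard (v : List A) : (Rext u v).ncard = (reF u v).card := by
  rw [← Set.ncard_coe_finset]; congr 1; ext a; simp [Rext, mem_reF]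

theorem Bext_ncard (v : List A) : (Bext u v).ncard = ∑ a ∈ leF u v, (reF u (a :: v)).card := by
  classical
  have : Bext u v = ((((leF u v).sigma (fun a => reF u (a :: v))).image
      (fun p => (p.1, p.2)) : Finset (A × A)) : Set (A × A)) := by
    ext ⟨a, b⟩
    simp only [Bext, Set.mem_ofPred_eq, Finset.coe_image, Set.mem_image, Finset.mem_coe,
      Finset.mem_sigma, mem_leF, mem_reF]
    constructor
    · intro h
      exact ⟨⟨a, b⟩, ⟨fac_sub ⟨[], [b], by simp⟩ h, h⟩, rfl⟩
    · rintro ⟨⟨a', b'⟩, ⟨-, h⟩, he⟩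
      cases he
      exact h
  rw [this, Set.ncard_coe_finset, Finset.card_image_of_injOn, Finset.card_sigma]
  rintro ⟨a, b⟩ - ⟨a', b'⟩ - h
  simp at h
  simp [h]

theorem bil_eq (v : List A) : bilateralOrder u v = bil u v := by
  simp only [bilateralOrder, bil, Lext_ncard, Rext_ncard, Bext_ncard, phi, Finset.sum_sub_distrib]
  push_cast
  simp
  ring

theorem bil_zero (hur : UniformlyRecurrent u)
    (h : ∀ w : List A, Bispecial u w → bilateralOrder u w = 0) {v : List A}
    (hv : IsFactor u v) : bil u v = 0 := by
  have hl : 1 ≤ (leF u v).card := by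
    obtain ⟨a, ha⟩ := exists_left hur hv
    exact Finset.card_pos.mpr ⟨a, mem_leF.mpr ha⟩
  have hr := phi_nonneg hv
  by_cases h1 : (leF u v).card = 1
  · obtain ⟨a, ha⟩ := Finset.card_eq_one.mp h1
    have : reF u (a :: v) = reF u v := by
      ext b
      rw [mem_reF, mem_reF]
      constructor
      · exact fac_sub (List.suffix_cons a _).isInfix
      · intro hb
        obtain ⟨a', ha'⟩ := exists_left hur hb
        have : a' ∈ leF u v := mem_leF.mpr (fac_sub ⟨[], [b], by simp⟩ ha')
        rw [ha, Finset.mem_singleton] at this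
        subst this
        exact ha'
    simp [bil, ha, phi, this]
  by_cases h2 : phi u v = 0
  · rw [bil, h2, sub_zero]
    apply Finset.sum_eq_zero
    intro a ha
    have h3 := phi_nonneg (mem_leF.mp ha)
    have h4 := phi_suffix (u := u) (List.suffix_cons a v)
    omega
  · rw [← bil_eq]
    apply h
    refine ⟨hv, ?_, ?_⟩
    · rw [Lext_ncard]; omega
    · rw [Rext_ncard]; unfold phi at *; omega

theorem suffix_ext {s y : List A} (h : s <:+ y) (hne : y ≠ s) : ∃ a, a :: s <:+ y := by
  obtain ⟨p, rfl⟩ := h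
  rcases List.eq_nil_or_concat p with h | ⟨p', a, rfl⟩
  · subst h; simp at hne
  · exact ⟨a, p', by simp⟩

theorem sum_le_one {X : Finset (List A)} {v : List A} (hv : phi u v ≤ 1)
    (h : ∀ y ∈ X, y ≠ v → phi u y = 0) : ∑ y ∈ X, phi u y ≤ 1 := by
  by_cases hx : v ∈ X
  · rw [Finset.sum_eq_single_of_mem v hx h]; exact hv
  · rw [Finset.sum_eq_zero]
    · norm_num
    · intro y hy
      exact h y hy (by rintro rfl; exact hx hy)

theorem not_weak (hcard : Fintype.card A = 3) (hur : UniformlyRecurrent u)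
    (hS : ∀ w (hw : IsFactor u w), ∑ v ∈ (Xs_finite hur hw).toFinset, phi u v = 2)
    {w : List A} (hw : IsFactor u w) : 0 ≤ bil u w := by
  by_contra! hneg
  have hle : phi u w ≤ 2 := by
    have := Finset.card_le_univ (reF u w)
    unfold phi; omega
  have hnn : ∀ a ∈ leF u w, 0 ≤ phi u (a :: w) := fun a ha => phi_nonneg (mem_leF.mp ha)
  have hsum : ∑ a ∈ leF u w, phi u (a :: w) < phi u w := by unfold bil at hneg; omega
  have hsum0 := Finset.sum_nonneg hnn
  have single : ∀ a ∈ leF u w, phi u (a :: w) ≤ ∑ a ∈ leF u w, phi u (a :: w) :=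
    fun a ha => Finset.single_le_sum (f := fun a => phi u (a :: w)) hnn ha
  have hwX : w ∈ (Xs_finite hur hw).toFinset := by simpa using mem_Xs_self hw
  have nnX : ∀ (w' : List A) (hw' : IsFactor u w'), ∀ v ∈ (Xs_finite hur hw').toFinset,
      0 ≤ phi u v := by
    intro w' hw' v hv
    rw [Set.Finite.mem_toFinset] at hv
    exact phi_nonneg hv.1
  classical
  have hX := hS w hw
  rw [← Finset.add_sum_erase _ _ hwX] at hX
  have nnE : ∀ v ∈ (Xs_finite hur hw).toFinset.erase w, 0 ≤ phi u v :=
    fun v hv => nnX w hw v (Finset.mem_of_mem_erase hv)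
  -- special words ending in a nontrivial occurrence of w
  have ext : ∀ y, IsFactor u y → w <:+ y → y ≠ w → 0 < phi u y →
      ∃ a ∈ leF u w, a :: w <:+ y ∧ 0 < phi u (a :: w) := by
    intro y hy hs hne hpos
    obtain ⟨a, ha⟩ := suffix_ext hs hne
    exact ⟨a, mem_leF.mpr (fac_sub ha.isInfix hy), ha, lt_of_lt_of_le hpos (phi_suffix ha)⟩
  by_cases h2 : phi u w = 2
  · have hz : ∀ v ∈ Xs u w, v ≠ w → phi u v = 0 := by
      intro v hv hne
      have hm : v ∈ (Xs_finite hur hw).toFinset.erase w := by simpa using ⟨hne, hv⟩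
      have := Finset.single_le_sum nnE hm
      have := nnE v hm
      omega
    have hy : ∀ a (ha : a ∈ leF u w), ∀ y ∈ Xs u (a :: w), 0 < phi u y →
        ∃ a' ∈ leF u w, a' :: w <:+ y ∧ 0 < phi u (a' :: w) := by
      intro a ha y hy hpos
      have hin : w <:+: y := (List.suffix_cons a w).isInfix.trans hy.2.1.isInfix
      obtain ⟨s, hs, hsX⟩ := last_occ hy.1 hin
      have hsw : s = w := by
        by_contra hne
        have := hz s hsX hne
        have := phi_suffix (u := u) hs
        omega
      subst hsw
      refine ext y hy.1 hs ?_ hpos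
      rintro rfl
      have := hy.2.1.length_le
      simp at this
    by_cases hex : ∃ a ∈ leF u w, 0 < phi u (a :: w)
    · obtain ⟨a, ha, hpos⟩ := hex
      have h1 := single a ha
      have hS' := hS _ (mem_leF.mp ha)
      have := sum_le_one (u := u) (X := (Xs_finite hur (mem_leF.mp ha)).toFinset) (v := a :: w)
        (by omega) (by
          intro y hyX hne
          have hy0 := nnX _ (mem_leF.mp ha) y hyX
          rw [Set.Finite.mem_toFinset] at hyX
          by_contra hne0
          obtain ⟨a', ha', hsuf, hpos'⟩ := hy a ha y hyX (by omega)
          have haa : a' = a := by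
            by_contra hneq
            have h3 : ∑ x ∈ {a, a'}, phi u (x :: w) ≤ ∑ x ∈ leF u w, phi u (x :: w) := by
              apply Finset.sum_le_sum_of_subset_of_nonneg
              · intro x hx
                simp at hx
                rcases hx with rfl | rfl <;> assumption
              · intro x hx _
                exact hnn x hx
            rw [Finset.sum_pair (Ne.symm hneq)] at h3
            omega
          subst haa
          exact hne (hyX.2.2 _ hsuf List.prefix_rfl).symm)
      omega
    · obtain ⟨a, ha⟩ := exists_left hur hw
      have hS' := hS _ ha
      rw [Finset.sum_eq_zero] at hS'
      · norm_num at hS'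
      · intro y hyX
        have hy0 := nnX _ ha y hyX
        rw [Set.Finite.mem_toFinset] at hyX
        by_contra hne0
        obtain ⟨a', ha', -, hpos'⟩ := hy a (mem_leF.mpr ha) y hyX (by omega)
        exact hex ⟨a', ha', hpos'⟩
  · have h1 : phi u w = 1 := by omega
    have hE1 : ∑ v ∈ (Xs_finite hur hw).toFinset.erase w, phi u v = 1 := by omega
    obtain ⟨v, hvE, hv0⟩ : ∃ v ∈ (Xs_finite hur hw).toFinset.erase w, phi u v ≠ 0 := by
      apply Finset.exists_ne_zero_of_sum_ne_zero
      omega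
    have hv1 := Finset.single_le_sum nnE hvE
    have hvn := nnE v hvE
    have hvz : ∀ s ∈ Xs u w, s ≠ w → s ≠ v → phi u s = 0 := by
      intro s hs hne hnv
      have hm : s ∈ (Xs_finite hur hw).toFinset.erase w := by simpa using ⟨hne, hs⟩
      have h3 : ∑ x ∈ {s, v}, phi u x ≤ ∑ x ∈ (Xs_finite hur hw).toFinset.erase w, phi u x := by
        apply Finset.sum_le_sum_of_subset_of_nonneg
        · intro x hx
          rw [Finset.mem_insert, Finset.mem_singleton] at hx
          rcases hx with rfl | rfl <;> assumption
        · intro x hx _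
          exact nnE x hx
      rw [Finset.sum_pair hnv] at h3
      have := nnE s hm
      omega
    have hvX : v ∈ Xs u w ∧ v ≠ w := by
      rw [Finset.mem_erase, Set.Finite.mem_toFinset] at hvE
      exact ⟨hvE.2, hvE.1⟩
    obtain ⟨⟨hvf, ⟨t, ht⟩, hvu⟩, hvne⟩ := hvX
    cases t with
    | nil => exact hvne (by simpa using ht.symm)
    | cons b t =>
      have hpre : w ++ [b] <+: v := ⟨t, by rw [← ht]; simp⟩
      have hwb : IsFactor u (w ++ [b]) := fac_sub hpre.isInfix hvf
      have hS' := hS _ hwb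
      have := sum_le_one (u := u) (X := (Xs_finite hur hwb).toFinset) (v := v) (by omega) (by
        intro y hyX hne
        have hy0 := nnX _ hwb y hyX
        rw [Set.Finite.mem_toFinset] at hyX
        by_contra hne0
        have hin : w <:+: y := (List.prefix_append w [b]).isInfix.trans hyX.2.1.isInfix
        obtain ⟨s, hs, hsX⟩ := last_occ hyX.1 hin
        have hps := phi_suffix (u := u) hs
        by_cases hsw : s = w
        · subst hsw
          obtain ⟨a, ha, -, hpos⟩ := ext y hyX.1 hs (by
            rintro rfl
            have := hyX.2.1.length_le
            simp at this) (by omega)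
          have := single a ha
          omega
        · by_cases hsv : s = v
          · subst hsv
            exact hne (hyX.2.2 s hs hpre).symm
          · have := hvz s hsX hsw hsv
            omega)
      omega

theorem phi_nil (hcard : Fintype.card A = 3) (hall : AllLettersOccur u) : phi u [] = 2 := by
  have : reF u [] = Finset.univ := by
    ext b
    simp only [mem_reF, Finset.mem_univ, iff_true]
    obtain ⟨i, hi⟩ := hall b
    exact ⟨i, by simp [OccursAt, word, hi]⟩
  rw [phi, this, Finset.card_univ, hcard]
  norm_num

end helpers

/-- For a uniformly recurrent ternary infinite word, every
bispecial factor is ordinary iff every factor has exactly three return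
words. -/
theorem stmt14 {A : Type*} [Fintype A] (u : ℕ → A)
    (hcard : Fintype.card A = 3)
    (hall : AllLettersOccur u)
    (hur : UniformlyRecurrent u) :
    (∀ w : List A, Bispecial u w → bilateralOrder u w = 0) ↔
      ∀ w : List A, IsFactor u w → Set.ncard (returnWords u w) = 3 := by
  constructor
  · intro h w hw
    have hA := lemmaA hur hw
    by_cases h0 : w = []
    · subst h0
      have : (Xs_finite hur hw).toFinset = {[]} := by
        ext v
        rw [Set.Finite.mem_toFinset, Finset.mem_singleton]
        constructor
        · intro hv
          exact (hv.2.2 [] List.nil_suffix List.prefix_rfl).symm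
        · rintro rfl
          exact mem_Xs_self hw
      rw [this, Finset.sum_singleton, phi_nil hcard hall] at hA
      omega
    · have hB := lemmaB hur hw h0
      rw [phi_nil hcard hall, Finset.sum_eq_zero (s := (Ts_finite hur hw).toFinset)] at hB
      · omega
      · intro v hv
        rw [Set.Finite.mem_toFinset] at hv
        exact bil_zero hur h hv.1
  · intro h w hw
    have hS : ∀ w (hw : IsFactor u w), ∑ v ∈ (Xs_finite hur hw).toFinset, phi u v = 2 := by
      intro w hw
      have hA := lemmaA hur hw
      rw [h w hw] at hA
      push_cast at hA
      omega
    rw [bil_eq]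
    have hx : IsFactor u (word u 0 (w.length + 1)) := ⟨0, occ_word _ _⟩
    have hB := lemmaB hur hx (by
      intro h
      have := congrArg List.length h
      simp [word_length] at this)
    rw [hS _ hx, phi_nil hcard hall] at hB
    have hm : w ∈ (Ts_finite hur hx).toFinset := by
      rw [Set.Finite.mem_toFinset]
      refine ⟨hw.1, fun hi => ?_⟩
      have := hi.length_le
      simp [word_length] at this
    have nn : ∀ v ∈ (Ts_finite hur hx).toFinset, 0 ≤ bil u v := by
      intro v hv
      rw [Set.Finite.mem_toFinset] at hv
      exact not_weak hcard hur hS hv.1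
    have h1 := Finset.single_le_sum nn hm
    have h2 := nn w hm
    omega
end
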